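/- Proposition 5.4 (the variety D∞∨N is fi-permutable): Let θ = θ_{D∞} ∩ θ_N, where θ_{D∞} = θ({x² ≈ x³, x²y ≈ yx², σ1, σ2, σ3}) and θ_N = θ({x² ≈ x³, x²y ≈ yx², xyxzx ≈ x²yz, σ2, σ3}) (θ is the equational theory of the join D∞ ∨ N). Then every two fully invariant congruences on F = FreeMonoid ℕ containing θ permute. -/

import Mathlib

/-! Common definitions: words, fully invariant congruences, identities and
named varieties from the paper. -/

/-- The free monoid over the countably infinite alphabet `ℕ`. -/
abbrev FM : Type := FreeMonoid ℕ

/-- The letters `x, y, z, s, t, h` (pairwise distinct elements of `ℕ`). -/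
def xL : FM := FreeMonoid.of 0
def yL : FM := FreeMonoid.of 1
def zL : FM := FreeMonoid.of 2
def sL : FM := FreeMonoid.of 3
def tL : FM := FreeMonoid.of 4
def hL : FM := FreeMonoid.of 5
/-- The indexed letters `z_i` and `t_i` (0-based; pairwise distinct, and distinct
from the named letters above). -/
def zV (i : ℕ) : FM := FreeMonoid.of (10 + 2 * i)
def tV (i : ℕ) : FM := FreeMonoid.of (11 + 2 * i)

/-- A congruence on the free monoid is fully invariant if it is stable under all
monoid endomorphisms. -/
def IsFullyInvariant (θ : Con FM) : Prop :=
  ∀ (σ : FM →* FM) (u v : FM), θ u v → θ (σ u) (σ v)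

/-- The smallest fully invariant congruence on `FM` containing a set of identities. -/
def fiCon (E : Set (FM × FM)) : Con FM :=
  sInf {c : Con FM | IsFullyInvariant c ∧ ∀ p ∈ E, c p.1 p.2}

/-- Two congruences (relations) permute: `α ∘ β = β ∘ α`. -/
def Permute (α β : Con FM) : Prop :=
  Relation.Comp (⇑α) (⇑β) = Relation.Comp (⇑β) (⇑α)

/-- A monoid `M` satisfies the identity `p.1 ≈ p.2`. -/
def MSatisfies (M : Type*) [Monoid M] (p : FM × FM) : Prop :=
  ∀ φ : FM →* M, φ p.1 = φ p.2

/-- A monoid `M` satisfies all identities of a congruence `θ`. -/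
def SatisfiesAll (θ : Con FM) (M : Type*) [Monoid M] : Prop :=
  ∀ u v : FM, θ u v → MSatisfies M (u, v)

/-- Every element of the monoid `M` has a two-sided inverse, i.e. `M` is a group. -/
def IsGroupMonoid (M : Type*) [Monoid M] : Prop :=
  ∀ m : M, ∃ m' : M, m * m' = 1 ∧ m' * m = 1

/-- The dual of a congruence: `θ^δ = {(rev u, rev v) : (u, v) ∈ θ}`. -/
def dualCon (θ : Con FM) : Con FM where
  r a b := θ a.reverse b.reverse
  iseqv := ⟨fun _ => θ.refl _, fun h => θ.symm h, fun h h' => θ.trans h h'⟩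
  mul' := fun {a b c d} h₁ h₂ => by
    show θ (a * c).reverse (b * d).reverse
    rw [FreeMonoid.reverse_mul, FreeMonoid.reverse_mul]
    exact θ.mul h₂ h₁

/-- σ1 : `xysxty ≈ yxsxty`. -/
def idσ1 : FM × FM := (xL*yL*sL*xL*tL*yL, yL*xL*sL*xL*tL*yL)
/-- σ2 : `xsytxy ≈ xsytyx`. -/
def idσ2 : FM × FM := (xL*sL*yL*tL*xL*yL, xL*sL*yL*tL*yL*xL)
/-- σ3 : `xsxyty ≈ xsyxty`. -/
def idσ3 : FM × FM := (xL*sL*xL*yL*tL*yL, xL*sL*yL*xL*tL*yL)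
/-- α1 : `xysxtxhy ≈ yxsxtxhy`. -/
def idα1 : FM × FM := (xL*yL*sL*xL*tL*xL*hL*yL, yL*xL*sL*xL*tL*xL*hL*yL)
/-- α2 : `xysxtyhx ≈ yxsxtyhx`. -/
def idα2 : FM × FM := (xL*yL*sL*xL*tL*yL*hL*xL, yL*xL*sL*xL*tL*yL*hL*xL)
/-- α3 : `xysytxhx ≈ yxsytxhx`. -/
def idα3 : FM × FM := (xL*yL*sL*yL*tL*xL*hL*xL, yL*xL*sL*yL*tL*xL*hL*xL)

/-- `aIdent i` is the identity `α_i` for `i ∈ {1, 2, 3}`. -/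
def aIdent (i : ℕ) : FM × FM := if i = 1 then idα1 else if i = 2 then idα2 else idα3
/-- `bIdent i` is `β_i`, obtained from `α_i` by reversing both sides. -/
def bIdent (i : ℕ) : FM × FM := ((aIdent i).1.reverse, (aIdent i).2.reverse)

/-- The ordered product `f 0 * f 1 * ⋯ * f (n-1)`. -/
def prodRange (n : ℕ) (f : ℕ → FM) : FM := ((List.range n).map f).prod
/-- The ordered product `f 0 * f 1 * ⋯ * f (n-1)` over `Fin n`. -/
def prodFin (n : ℕ) (f : Fin n → FM) : FM := ((List.finRange n).map f).prod

/-- The word `w_n[π,τ]` (0-based indices). -/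
def wWord (n : ℕ) (π τ : Equiv.Perm (Fin n)) : FM :=
  prodRange n (fun i => zV i * tV i) * xL *
    prodFin n (fun i => zV (π i) * zV (n + τ i)) * xL *
    prodRange n (fun i => tV (n + i) * zV (n + i))

/-- The word `w_n'[π,τ]`. -/
def wWord' (n : ℕ) (π τ : Equiv.Perm (Fin n)) : FM :=
  prodRange n (fun i => zV i * tV i) * (xL * xL) *
    prodFin n (fun i => zV (π i) * zV (n + τ i)) *
    prodRange n (fun i => tV (n + i) * zV (n + i))

/-- The word `c_{n,m}[ρ]`. -/
def cWord (n m : ℕ) (ρ : Equiv.Perm (Fin (n + m))) : FM :=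
  prodRange n (fun i => zV i * tV i) * (xL * yL) * tL *
    prodRange m (fun i => zV (n + i) * tV (n + i)) * xL *
    prodFin (n + m) (fun i => zV (ρ i)) * yL

/-- The word `c'_{n,m}[ρ]`. -/
def cWord' (n m : ℕ) (ρ : Equiv.Perm (Fin (n + m))) : FM :=
  prodRange n (fun i => zV i * tV i) * (yL * xL) * tL *
    prodRange m (fun i => zV (n + i) * tV (n + i)) * xL *
    prodFin (n + m) (fun i => zV (ρ i)) * yL

/-- The word `c_{n,m,k}[ρ]`. -/
def cWord3 (n m k : ℕ) (ρ : Equiv.Perm (Fin (n + m + k))) : FM :=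
  prodRange n (fun i => zV i * tV i) * (xL * yL) * tL *
    prodRange m (fun i => zV (n + i) * tV (n + i)) * xL *
    prodFin (n + m + k) (fun i => zV (ρ i)) * yL *
    prodRange k (fun i => tV (n + m + i) * zV (n + m + i))

/-- The word `c'_{n,m,k}[ρ]`. -/
def cWord3' (n m k : ℕ) (ρ : Equiv.Perm (Fin (n + m + k))) : FM :=
  prodRange n (fun i => zV i * tV i) * (yL * xL) * tL *
    prodRange m (fun i => zV (n + i) * tV (n + i)) * xL *
    prodFin (n + m + k) (fun i => zV (ρ i)) * yL *
    prodRange k (fun i => tV (n + m + i) * zV (n + m + i))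

/-- The equational theory of `D_∞`. -/
def θDinf : Con FM :=
  fiCon {(xL^2, xL^3), (xL^2 * yL, yL * xL^2), idσ1, idσ2, idσ3}
/-- The equational theory of `N`. -/
def θN : Con FM :=
  fiCon {(xL^2, xL^3), (xL^2 * yL, yL * xL^2), (xL*yL*xL*zL*xL, xL^2*yL*zL), idσ2, idσ3}
/-- The equational theory of `K`. -/
def θK : Con FM :=
  fiCon {(xL^2*yL, xL^2*yL*xL), (xL*yL*xL, xL*yL*xL^2), (xL^2*yL^2, yL^2*xL^2)}
/-- The identity basis of `P_n`. -/
def basisP (n : ℕ) : Set (FM × FM) :=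
  {(xL^n, xL^(n+1)), (xL^n * yL, yL * xL^n), (xL^2*yL, xL*yL*xL)}
/-- The equational theory of `P_n`. -/
def θP (n : ℕ) : Con FM := fiCon (basisP n)
/-- The equational theory of `R`. -/
def θR : Con FM :=
  fiCon ({(xL^2, xL^3), (xL^2*yL, yL*xL^2), idσ1, idσ2} ∪
    {p : FM × FM | ∃ (n : ℕ) (π τ : Equiv.Perm (Fin n)),
        1 ≤ n ∧ p = (wWord n π τ, wWord' n π τ)})
/-- The equational theory of `Q_{r,s}`. -/
def θQ (r s : ℕ) : Con FM :=
  fiCon ({(xL^2, xL^3), (xL^2*yL, yL*xL^2), idσ3} ∪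
    {p : FM × FM | ∃ i : ℕ, (i = 1 ∨ i = 2 ∨ i = 3) ∧ i ≠ r ∧ p = aIdent i} ∪
    {p : FM × FM | ∃ j : ℕ, (j = 1 ∨ j = 2 ∨ j = 3) ∧ j ≠ s ∧ p = bIdent j} ∪
    {p : FM × FM | ∃ (n m : ℕ) (ρ : Equiv.Perm (Fin (n + m))),
        p = (cWord n m ρ, cWord' n m ρ) ∨
        p = ((cWord n m ρ).reverse, (cWord' n m ρ).reverse)})
/-- The equational theory of the variety `SL` of semilattice monoids. -/
def θSL : Con FM := fiCon {(xL, xL^2), (xL*yL, yL*xL)}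

/-- `u` is a factor (contiguous subword) of `w`. -/
def IsFactor (u w : FM) : Prop := ∃ p q : FM, p * u * q = w

lemma isFactor_left {a b w : FM} (h : IsFactor (a * b) w) : IsFactor a w := by
  obtain ⟨p, q, hpq⟩ := h
  exact ⟨p, b * q, by rw [← hpq]; simp [mul_assoc]⟩

lemma isFactor_right {a b w : FM} (h : IsFactor (a * b) w) : IsFactor b w := by
  obtain ⟨p, q, hpq⟩ := h
  exact ⟨p * a, q, by rw [← hpq]; simp [mul_assoc]⟩

/-- The Rees congruence associated with the ideal of non-factors of `w`. -/
def reesCon (w : FM) : Con FM where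
  r u v := u = v ∨ (¬ IsFactor u w ∧ ¬ IsFactor v w)
  iseqv := by
    refine ⟨fun _ => Or.inl rfl, ?_, ?_⟩
    · intro a b h
      rcases h with rfl | ⟨h1, h2⟩
      · exact Or.inl rfl
      · exact Or.inr ⟨h2, h1⟩
    · intro a b c h h'
      rcases h with rfl | ⟨h1, h2⟩
      · exact h'
      · rcases h' with rfl | ⟨h3, h4⟩
        · exact Or.inr ⟨h1, h2⟩
        · exact Or.inr ⟨h1, h4⟩
  mul' := by
    rintro a b c d (rfl | ⟨h1, h2⟩) (rfl | ⟨h3, h4⟩)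
    · exact Or.inl rfl
    · exact Or.inr ⟨fun h => h3 (isFactor_right h), fun h => h4 (isFactor_right h)⟩
    · exact Or.inr ⟨fun h => h1 (isFactor_left h), fun h => h2 (isFactor_left h)⟩
    · exact Or.inr ⟨fun h => h1 (isFactor_left h), fun h => h2 (isFactor_left h)⟩

/-- The Rees quotient monoid `S(w)`. -/
abbrev SMon (w : FM) : Type := (reesCon w).Quotient

/-- The number of occurrences of the letter `a` in the word `w`. -/
def occ (w : FM) (a : ℕ) : ℕ := (FreeMonoid.toList w).count a

/-- A word in which every letter occurs at most once. -/
def LinearW (w : FM) : Prop := ∀ a : ℕ, occ w a ≤ 1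

/-- Assemble the word `b0 * t_1 * b_1 * ⋯ * t_m * b_m` from a first block and a list
of (simple letter, block) pairs. -/
def assemble (b0 : FM) (rest : List (ℕ × FM)) : FM :=
  b0 * (rest.map (fun p => FreeMonoid.of p.1 * p.2)).prod

/-- `(b0, rest)` is the decomposition of `w` into alternating simple letters and blocks
consisting of multiple letters. -/
def IsDecomposition (w : FM) (b0 : FM) (rest : List (ℕ × FM)) : Prop :=
  w = assemble b0 rest ∧
  (∀ p ∈ rest, occ w p.1 = 1) ∧
  (∀ a ∈ FreeMonoid.toList b0, 2 ≤ occ w a) ∧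
  (∀ p ∈ rest, ∀ a ∈ FreeMonoid.toList p.2, 2 ≤ occ w a)

/-- The identity `u ≈ v` is linear-balanced. -/
def LinearBalanced (u v : FM) : Prop :=
  ∃ (b0 c0 : FM) (urest vrest : List (ℕ × FM)),
    IsDecomposition u b0 urest ∧ IsDecomposition v c0 vrest ∧
    urest.map Prod.fst = vrest.map Prod.fst ∧
    ∀ a : ℕ, (2 ≤ occ u a ∨ 2 ≤ occ v a) →
      occ b0 a = occ c0 a ∧ occ b0 a ≤ 1 ∧
      ∀ q ∈ urest.zip vrest, occ q.1.2 a = occ q.2.2 a ∧ occ q.1.2 a ≤ 1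

/-- `w` is an isoterm for `θ`. -/
def IsIsoterm (θ : Con FM) (w : FM) : Prop := ∀ w' : FM, θ w w' → w' = w

/-- The relation, read on lists of letters, of a fully invariant congruence satisfying the
identities common to `D∞` and `N` that govern commutation of adjacent letters. -/
structure Admissible (R : List ℕ → List ℕ → Prop) : Prop where
  refl : ∀ u, R u u
  symm : ∀ {u v}, R u v → R v u
  trans : ∀ {u v w}, R u v → R v w → R u w
  app : ∀ {u v u' v'}, R u v → R u' v' → R (u ++ u') (v ++ v')
  subst : ∀ (f : ℕ → List ℕ) {u v}, R u v → R (u.flatMap f) (v.flatMap f)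
  cube : ∀ x, R (x ++ x) (x ++ x ++ x)
  comm : ∀ x y, R (x ++ x ++ y) (y ++ x ++ x)
  late : ∀ x y s t, R (x ++ s ++ y ++ t ++ x ++ y) (x ++ s ++ y ++ t ++ y ++ x)
  mid : ∀ x y s t, R (x ++ s ++ x ++ y ++ t ++ y) (x ++ s ++ y ++ x ++ t ++ y)
  early₁ : ∀ x y s t h,
    R (x ++ y ++ s ++ x ++ t ++ x ++ h ++ y) (y ++ x ++ s ++ x ++ t ++ x ++ h ++ y)
  early₂ : ∀ x y s t h,
    R (x ++ y ++ s ++ x ++ t ++ y ++ h ++ x) (y ++ x ++ s ++ x ++ t ++ y ++ h ++ x)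
  early₃ : ∀ x y s t h,
    R (x ++ y ++ s ++ y ++ t ++ x ++ h ++ x) (y ++ x ++ s ++ y ++ t ++ x ++ h ++ x)

/-- The subword of `u` on the letters in `S`. -/
def proj (S : Finset ℕ) (u : List ℕ) : List ℕ := u.filter (· ∈ S)

/-- The word with all occurrences of `x` deleted. -/
def del (x : ℕ) (u : List ℕ) : List ℕ := u.filter (· ≠ x)

lemma proj_append (S : Finset ℕ) (u v : List ℕ) : proj S (u ++ v) = proj S u ++ proj S v :=
  List.filter_append ..

lemma proj_cons_mem {S : Finset ℕ} {a : ℕ} (h : a ∈ S) (u : List ℕ) :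
    proj S (a :: u) = a :: proj S u := by simp [proj, h]

lemma proj_cons_notMem {S : Finset ℕ} {a : ℕ} (h : a ∉ S) (u : List ℕ) :
    proj S (a :: u) = proj S u := by simp [proj, h]

lemma proj_proj {S S' : Finset ℕ} (h : S ⊆ S') (u : List ℕ) : proj S (proj S' u) = proj S u := by
  simp only [proj, List.filter_filter]
  refine List.filter_congr fun a _ => ?_
  have := @h a
  by_cases ha : a ∈ S <;> simp [ha, this]

lemma proj_congr {S S' : Finset ℕ} {u : List ℕ} (h : ∀ a ∈ u, a ∈ S ↔ a ∈ S') :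
    proj S u = proj S' u :=
  List.filter_congr fun a ha => by simp [h a ha]

lemma proj_eq_nil {S : Finset ℕ} {u : List ℕ} (h : ∀ a ∈ u, a ∉ S) : proj S u = [] := by
  simpa [proj] using h

lemma mem_proj {S : Finset ℕ} {u : List ℕ} {a : ℕ} : a ∈ proj S u ↔ a ∈ u ∧ a ∈ S := by
  simp [proj]

lemma count_proj {S : Finset ℕ} {a : ℕ} (h : a ∈ S) (u : List ℕ) :
    (proj S u).count a = u.count a := by
  rw [proj, List.count_filter]; simpa using h

lemma proj_eq_of_subset {S S' : Finset ℕ} (h : S ⊆ S') {u v : List ℕ}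
    (e : proj S' u = proj S' v) : proj S u = proj S v := by
  rw [← proj_proj h, e, proj_proj h]

lemma del_append (x : ℕ) (u v : List ℕ) : del x (u ++ v) = del x u ++ del x v :=
  List.filter_append ..

lemma proj_del {S : Finset ℕ} {x : ℕ} (h : x ∉ S) (u : List ℕ) : proj S (del x u) = proj S u := by
  simp only [proj, del, List.filter_filter]
  refine List.filter_congr fun a _ => ?_
  by_cases ha : a ∈ S
  · have : a ≠ x := fun e => h (e ▸ ha)
    simp [ha, this]
  · simp [ha]

lemma del_comm (x y : ℕ) (u : List ℕ) : del x (del y u) = del y (del x u) :=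
  List.filter_comm ..

lemma count_del_of_ne {x a : ℕ} (h : a ≠ x) (u : List ℕ) : (del x u).count a = u.count a := by
  rw [del, List.count_filter]; simpa using h

lemma count_del_self (x : ℕ) (u : List ℕ) : (del x u).count x = 0 := by
  rw [List.count_eq_zero]; simp [del]

lemma exists_split_of_two_le_count {a : ℕ} {l : List ℕ} (h : 2 ≤ l.count a) :
    ∃ l₁ l₂ l₃, l = l₁ ++ a :: l₂ ++ a :: l₃ := by
  have h1 : a ∈ l := List.count_pos_iff.1 (by omega)
  obtain ⟨p, q, rfl, hp⟩ := List.eq_append_cons_of_mem h1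
  rw [List.count_append, List.count_eq_zero.2 hp, List.count_cons_self] at h
  obtain ⟨q₁, q₂, rfl⟩ := List.append_of_mem (List.count_pos_iff.1 (show 0 < q.count a by omega))
  exact ⟨p, q₁, q₂, by simp⟩

namespace Admissible

variable {R : List ℕ → List ℕ → Prop} (hR : Admissible R)
include hR

lemma ctx (p q : List ℕ) {u v : List ℕ} (h : R u v) : R (p ++ u ++ q) (p ++ v ++ q) :=
  hR.app (hR.app (hR.refl p) h) (hR.refl q)

lemma filter (p : ℕ → Bool) {u v : List ℕ} (h : R u v) : R (u.filter p) (v.filter p) := by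
  have key : ∀ w : List ℕ, w.flatMap (fun a => if p a then [a] else []) = w.filter p := by
    intro w
    induction w with
    | nil => rfl
    | cons a w ih => by_cases hp : p a <;> simp [hp, ih]
  simpa only [key] using hR.subst (fun a => if p a then [a] else []) h

lemma project (S : Finset ℕ) {u v : List ℕ} (h : R u v) : R (proj S u) (proj S v) := hR.filter _ h

lemma delete (x : ℕ) {u v : List ℕ} (h : R u v) : R (del x u) (del x v) := hR.filter _ h

lemma swap_late {c r : List ℕ} {a b : ℕ} (ha : a ∈ c) (hb : b ∈ c) (hab : a ≠ b) :
    R (c ++ a :: b :: r) (c ++ b :: a :: r) := by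
  obtain ⟨c₁, c₂, rfl⟩ := List.append_of_mem ha
  rw [List.mem_append, List.mem_cons] at hb
  rcases hb with hb | rfl | hb
  · obtain ⟨d₁, d₂, rfl⟩ := List.append_of_mem hb
    simpa using hR.symm (hR.ctx d₁ r (hR.late [b] [a] d₂ c₂))
  · exact absurd rfl hab
  · obtain ⟨d₁, d₂, rfl⟩ := List.append_of_mem hb
    simpa using hR.ctx c₁ r (hR.late [a] [b] d₁ d₂)

lemma swap_mid {c r : List ℕ} {a b : ℕ} (ha : a ∈ c) (hb : b ∈ r) :
    R (c ++ a :: b :: r) (c ++ b :: a :: r) := by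
  obtain ⟨c₁, c₂, rfl⟩ := List.append_of_mem ha
  obtain ⟨d₁, d₂, rfl⟩ := List.append_of_mem hb
  simpa using hR.ctx c₁ d₂ (hR.mid [a] [b] c₂ d₁)

lemma swap_early {c r : List ℕ} {a b : ℕ} (ha : 2 ≤ r.count a) (hb : b ∈ r) (hab : a ≠ b) :
    R (c ++ a :: b :: r) (c ++ b :: a :: r) := by
  obtain ⟨r₁, r₂, rfl⟩ := List.append_of_mem hb
  rw [List.count_append, List.count_cons_of_ne hab.symm] at ha
  rcases Nat.lt_or_ge (r₁.count a) 1 with h1 | h1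
  · obtain ⟨s₁, s₂, s₃, rfl⟩ := exists_split_of_two_le_count (show 2 ≤ r₂.count a by omega)
    simpa using hR.ctx c s₃ (hR.early₃ [a] [b] r₁ s₁ s₂)
  rcases Nat.lt_or_ge (r₁.count a) 2 with h2 | h2
  · obtain ⟨s₁, s₂, rfl⟩ := List.append_of_mem (List.count_pos_iff.1 h1)
    obtain ⟨s₃, s₄, rfl⟩ := List.append_of_mem
      (List.count_pos_iff.1 (show 0 < r₂.count a by omega))
    simpa using hR.ctx c s₄ (hR.early₂ [a] [b] s₁ s₂ s₃)
  · obtain ⟨s₁, s₂, s₃, rfl⟩ := exists_split_of_two_le_count h2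
    simpa using hR.ctx c r₂ (hR.early₁ [a] [b] s₁ s₂ s₃)

/-- Adjacent occurrences of distinct multiple letters commute, unless both are the first of
exactly two occurrences. -/
lemma swap {c r : List ℕ} {a b : ℕ} (hab : a ≠ b) (ha : 1 ≤ c.count a + r.count a)
    (hb : 1 ≤ c.count b + r.count b)
    (h : 1 ≤ c.count a ∨ 1 ≤ c.count b ∨ 2 ≤ r.count a ∨ 2 ≤ r.count b) :
    R (c ++ a :: b :: r) (c ++ b :: a :: r) := by
  by_cases hac : a ∈ c
  · by_cases hbc : b ∈ c
    · exact hR.swap_late hac hbc hab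
    · rw [List.count_eq_zero.2 hbc] at hb
      exact hR.swap_mid hac (List.count_pos_iff.1 (by omega))
  · rw [List.count_eq_zero.2 hac] at ha h
    have har : a ∈ r := List.count_pos_iff.1 (by omega)
    by_cases hbc : b ∈ c
    · exact hR.symm (hR.swap_mid hbc har)
    · rw [List.count_eq_zero.2 hbc] at hb h
      have hbr : b ∈ r := List.count_pos_iff.1 (by omega)
      rcases h with h | h | h | h
      · omega
      · omega
      · exact hR.swap_early h hbr hab
      · exact hR.symm (hR.swap_early h har hab.symm)

/-- A letter moves to the left across a factor if it may be swapped with each of its letters. -/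
lemma move {c p : List ℕ} {a : ℕ} : ∀ {q : List ℕ},
    (∀ p₁ b p₂, p = p₁ ++ b :: p₂ →
      R (c ++ p₁ ++ b :: a :: (p₂ ++ q)) (c ++ p₁ ++ a :: b :: (p₂ ++ q))) →
    R (c ++ p ++ a :: q) (c ++ a :: (p ++ q)) := by
  induction p using List.reverseRecOn with
  | nil => intro q _; simpa using hR.refl _
  | append_singleton p b ih =>
    intro q h
    have h1 := h p b [] rfl
    have h2 := ih (q := b :: q) fun p₁ b' p₂ e => by
      simpa using h p₁ b' (p₂ ++ [b]) (by simp [e])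
    simpa using hR.trans (by simpa using h1) (by simpa using h2)

/-- A non-first occurrence of a letter moves to the left across multiple letters. -/
lemma move_of_mem {c p q : List ℕ} {a : ℕ} (hac : a ∈ c) (hap : a ∉ p)
    (h : ∀ b ∈ p, 2 ≤ (c ++ p ++ a :: q).count b) :
    R (c ++ p ++ a :: q) (c ++ a :: (p ++ q)) := by
  refine hR.move ?_
  rintro p₁ b p₂ rfl
  have hb := h b (by simp)
  have hne : b ≠ a := by rintro rfl; simp at hap
  have hca : 1 ≤ c.count a := List.count_pos_iff.2 hac
  simp only [List.count_append, List.count_cons_self, List.count_cons_of_ne hne.symm] at hb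
  refine hR.swap hne ?_ ?_ ?_ <;> simp only [List.count_append] <;> omega

/-- A square absorbs all other occurrences of its letter. -/
lemma square_absorb (x : ℕ) (w : List ℕ) : R (x :: x :: w) (x :: x :: del x w) := by
  induction w with
  | nil => exact hR.refl _
  | cons a w ih =>
    by_cases h : a = x
    · subst h
      have h1 := hR.symm (hR.ctx [] w (hR.cube [a]))
      simpa [del] using hR.trans h1 ih
    · have h1 := hR.ctx [] w (hR.comm [x] [a])
      have h2 := hR.ctx [a] [] ih
      have h3 := hR.symm (hR.ctx [] (del x w) (hR.comm [x] [a]))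
      have := hR.trans (by simpa using h1) (hR.trans (by simpa using h2) (by simpa using h3))
      simpa [del, h] using this

lemma square_central {u p r : List ℕ} {x : ℕ} (h : R u (p ++ x :: x :: r)) :
    R u (x :: x :: del x (p ++ r)) := by
  have h1 := hR.symm (hR.ctx [] r (hR.comm [x] p))
  exact hR.trans h (hR.trans (by simpa using h1) (hR.square_absorb x (p ++ r)))

end Admissible

/-- The product `x p₁ x p₂ x ⋯ pₖ x`. -/
def interleave (x : List ℕ) : List (List ℕ) → List ℕ
  | [] => x
  | p :: ps => x ++ p ++ interleave x ps

/-- The identity `x t₁ x ⋯ tₖ x ≈ x² t₁ ⋯ tₖ`. -/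
def Gathers (R : List ℕ → List ℕ → Prop) (k : ℕ) : Prop :=
  ∀ (x : List ℕ) (ps : List (List ℕ)), ps.length = k →
    R (interleave x ps) (x ++ x ++ ps.flatten)

/-- The identity `σ₁`. -/
def SwapsFirst (R : List ℕ → List ℕ → Prop) : Prop :=
  ∀ x y s t : List ℕ, R (x ++ y ++ s ++ x ++ t ++ y) (y ++ x ++ s ++ x ++ t ++ y)

/-- The identity `xysxy ≈ yxsxy`. -/
def SwapsParallel (R : List ℕ → List ℕ → Prop) : Prop :=
  ∀ x y s : List ℕ, R (x ++ y ++ s ++ x ++ y) (y ++ x ++ s ++ x ++ y)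

/-- Two occurrences of `x` in `u` are not separated by a letter of `T`. -/
def HasSquare (T : Finset ℕ) (x : ℕ) (u : List ℕ) : Prop :=
  ∃ a b, proj (insert x T) u = a ++ x :: x :: b

/-- `x²` can be split off from `u`. -/
def Central (R : List ℕ → List ℕ → Prop) (x : ℕ) (u : List ℕ) : Prop :=
  R u (x :: x :: del x u)

/-- The positions of `x` in `u` force `x` to be central. -/
def Collapses (R : List ℕ → List ℕ → Prop) (T : Finset ℕ) (x : ℕ) (u : List ℕ) : Prop :=
  HasSquare T x u ∨ ∃ k, 1 ≤ k ∧ k + 1 ≤ u.count x ∧ Gathers R k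

lemma SwapsFirst.swapsParallel {R : List ℕ → List ℕ → Prop} (h : SwapsFirst R) :
    SwapsParallel R := fun x y s => by simpa using h x y s []

lemma exists_eq_interleave (x : ℕ) : ∀ (k : ℕ) (u : List ℕ), k + 1 ≤ u.count x →
    ∃ p ps r, ps.length = k ∧ u = p ++ interleave [x] ps ++ r
  | 0, u, h => by
    obtain ⟨p, r, rfl⟩ := List.append_of_mem (List.count_pos_iff.1 (show 0 < u.count x by omega))
    exact ⟨p, [], r, rfl, by simp [interleave]⟩
  | k + 1, u, h => by
    obtain ⟨p, r, rfl, hp⟩ :=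
      List.eq_append_cons_of_mem (List.count_pos_iff.1 (show 0 < u.count x by omega))
    rw [List.count_append, List.count_eq_zero.2 hp, List.count_cons_self] at h
    obtain ⟨p', ps, r', hl, rfl⟩ := exists_eq_interleave x k r (by omega)
    exact ⟨p, p' :: ps, r', by simp [hl], by simp [interleave]⟩

lemma HasSquare.exists_split {T : Finset ℕ} {x : ℕ} {u : List ℕ} (h : HasSquare T x u) :
    ∃ p q r, u = p ++ x :: (q ++ x :: r) ∧ x ∉ q ∧ ∀ b ∈ q, b ∉ T := by
  obtain ⟨a, b, h⟩ := h
  rw [proj, List.filter_eq_append_iff] at h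
  obtain ⟨l₁, l₂, rfl, -, h⟩ := h
  rw [List.filter_eq_cons_iff] at h
  obtain ⟨m₁, m₂, rfl, -, -, h⟩ := h
  rw [List.filter_eq_cons_iff] at h
  obtain ⟨n₁, n₂, rfl, hn, -, -⟩ := h
  refine ⟨l₁ ++ m₁, n₁, n₂, by simp, fun hx => ?_, fun b hb hT => ?_⟩
  · simpa using hn x hx
  · simpa [hT] using hn b hb

namespace Admissible

variable {R : List ℕ → List ℕ → Prop} (hR : Admissible R)
include hR

lemma gathers_succ {k : ℕ} (h : Gathers R k) : Gathers R (k + 1) := by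
  rintro x (_ | ⟨p, ps⟩) hl
  · simp at hl
  · have h1 := hR.ctx (x ++ p) [] (h x ps (by simpa using hl))
    have h2 := hR.symm (hR.ctx x ps.flatten (hR.comm x p))
    have h3 := hR.symm (hR.ctx [] (p ++ ps.flatten) (hR.cube x))
    have := hR.trans (by simpa using h1) (hR.trans (by simpa using h2) (by simpa using h3))
    simpa [interleave] using this

lemma gathers_mono {k l : ℕ} (hkl : k ≤ l) (h : Gathers R k) : Gathers R l := by
  induction l, hkl using Nat.le_induction with
  | base => exact h
  | succ l _ ih => exact hR.gathers_succ ih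

lemma central_of_hasSquare {T : Finset ℕ} {x : ℕ} {u : List ℕ}
    (hT : ∀ a ∈ u, a ∈ T ↔ u.count a = 1) (h : HasSquare T x u) : Central R x u := by
  obtain ⟨p, q, r, rfl, hxq, hq⟩ := h.exists_split
  have h1 : R (p ++ [x] ++ q ++ x :: r) (p ++ [x] ++ x :: (q ++ r)) := by
    refine hR.move_of_mem (by simp) hxq fun b hb => ?_
    have hb' : b ∈ p ++ x :: (q ++ x :: r) := by simp [hb]
    have h1 := (hT b hb').not.1 (hq b hb)
    have h2 := List.count_pos_iff.2 hb'
    simp only [List.append_assoc, List.cons_append, List.nil_append] at *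
    omega
  have := hR.square_central (u := p ++ x :: (q ++ x :: r)) (p := p) (r := q ++ r) (x := x)
    (by simpa using h1)
  simpa [Central, del] using this

lemma central_of_gathers {k x : ℕ} {u : List ℕ} (hk : Gathers R k) (h : k + 1 ≤ u.count x) :
    Central R x u := by
  obtain ⟨p, ps, r, hl, rfl⟩ := exists_eq_interleave x k u h
  have h1 := hR.ctx p r (hk [x] ps hl)
  have h2 := hR.square_central (u := p ++ interleave [x] ps ++ r) (p := p)
    (r := ps.flatten ++ r) (x := x) (by simpa using h1)
  have h3 : ∀ ps, del x (interleave [x] ps) = del x ps.flatten := by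
    intro ps
    induction ps with
    | nil => simp [interleave, del]
    | cons p ps ih =>
      have : del x [x] = [] := by simp [del]
      rw [interleave, del_append, del_append, ih, this, List.flatten_cons, del_append,
        List.nil_append]
  simpa [Central, del_append, h3] using h2

lemma central_of_collapses {T : Finset ℕ} {x : ℕ} {u : List ℕ}
    (hT : ∀ a ∈ u, a ∈ T ↔ u.count a = 1) (h : Collapses R T x u) : Central R x u := by
  rcases h with h | ⟨k, -, hk, h⟩
  · exact hR.central_of_hasSquare hT h
  · exact hR.central_of_gathers h hk

end Admissible

/-- The first letter of `u` among `x` and `y`. -/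
def firstOf (x y : ℕ) (u : List ℕ) : Option ℕ := (proj {x, y} u).head?

/-- The letters `x` and `y` have the same positions in `u` relative to the letters of `T`. -/
def SameBlocks (T : Finset ℕ) (x y : ℕ) (u : List ℕ) : Prop :=
  ∀ s ∈ T, (proj {x, s} u).map (· == s) = (proj {y, s} u).map (· == s)

lemma SameBlocks.symm {T : Finset ℕ} {x y : ℕ} {u : List ℕ} (h : SameBlocks T x y u) :
    SameBlocks T y x u := fun s hs => (h s hs).symm

lemma SameBlocks.not_mem_between {T : Finset ℕ} {a b z : ℕ} {c r₁ r₂ r₃ : List ℕ}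
    (h : SameBlocks T a b (c ++ b :: a :: (r₁ ++ a :: (r₂ ++ b :: r₃)))) (hab : a ≠ b)
    (hb : (c ++ b :: a :: (r₁ ++ a :: (r₂ ++ b :: r₃))).count b = 2)
    (ha : (c ++ b :: a :: (r₁ ++ a :: (r₂ ++ b :: r₃))).count a = 2)
    (hz : (c ++ b :: a :: (r₁ ++ a :: (r₂ ++ b :: r₃))).count z = 1) (hzr : z ∈ r₂) : z ∉ T := by
  intro hzT
  have hza : z ≠ a := by rintro rfl; omega
  have hzb : z ≠ b := by rintro rfl; omega
  obtain ⟨s₁, s₂, rfl⟩ := List.append_of_mem hzr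
  have h := h z hzT
  simp only [List.count_append, List.count_cons_self, List.count_cons_of_ne hab,
    List.count_cons_of_ne hab.symm, List.count_cons_of_ne hza, List.count_cons_of_ne hza.symm,
    List.count_cons_of_ne hzb, List.count_cons_of_ne hzb.symm] at ha hb hz
  have e : ∀ w : List ℕ, ∀ y, w.count y = 0 → w.count z = 0 → proj {y, z} w = [] := by
    intro w y h1 h2
    refine proj_eq_nil fun d hd hd' => ?_
    simp only [Finset.mem_insert, Finset.mem_singleton] at hd'
    rcases hd' with rfl | rfl
    · exact List.count_eq_zero.1 h1 hd
    · exact List.count_eq_zero.1 h2 hd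
  have ha1 : a ∈ ({a, z} : Finset ℕ) := by simp
  have hz1 : z ∈ ({a, z} : Finset ℕ) := by simp
  have hb1 : b ∉ ({a, z} : Finset ℕ) := by simp [hab.symm, hzb.symm]
  have ha2 : a ∉ ({b, z} : Finset ℕ) := by simp [hab, hza.symm]
  have hz2 : z ∈ ({b, z} : Finset ℕ) := by simp
  have hb2 : b ∈ ({b, z} : Finset ℕ) := by simp
  simp only [proj_append, proj_cons_mem ha1, proj_cons_mem hz1, proj_cons_mem hb2,
    proj_cons_mem hz2, proj_cons_notMem hb1, proj_cons_notMem ha2] at h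
  rw [e c a (by omega) (by omega), e c b (by omega) (by omega), e r₁ a (by omega) (by omega),
    e r₁ b (by omega) (by omega), e s₁ a (by omega) (by omega), e s₁ b (by omega) (by omega)] at h
  simp [hza.symm, hzb.symm] at h

namespace Admissible

variable {R : List ℕ → List ℕ → Prop} (hR : Admissible R)
include hR

lemma swap_parallel_aux {T : Finset ℕ} {a b : ℕ} {c r₁ r₂ r₃ : List ℕ}
    (hP : SwapsParallel R) (hab : a ≠ b)
    (h : SameBlocks T a b (c ++ b :: a :: (r₁ ++ a :: (r₂ ++ b :: r₃))))
    (hT : ∀ z ∈ r₂, z ∈ T ↔ (c ++ b :: a :: (r₁ ++ a :: (r₂ ++ b :: r₃))).count z = 1)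
    (hb : (c ++ b :: a :: (r₁ ++ a :: (r₂ ++ b :: r₃))).count b = 2)
    (ha : (c ++ b :: a :: (r₁ ++ a :: (r₂ ++ b :: r₃))).count a = 2) :
    R (c ++ b :: a :: (r₁ ++ a :: (r₂ ++ b :: r₃)))
      (c ++ a :: b :: (r₁ ++ a :: (r₂ ++ b :: r₃))) := by
  have hz : ∀ z ∈ r₂, 2 ≤ (c ++ b :: a :: (r₁ ++ a :: (r₂ ++ b :: r₃))).count z := by
    intro z hz
    by_contra hlt
    have h0 := List.count_pos_iff.2 (show z ∈ c ++ b :: a :: (r₁ ++ a :: (r₂ ++ b :: r₃)) by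
      simp [hz])
    have h1 : (c ++ b :: a :: (r₁ ++ a :: (r₂ ++ b :: r₃))).count z = 1 := by omega
    exact h.not_mem_between hab hb ha h1 hz ((hT z hz).2 h1)
  have hbr : b ∉ r₂ := by
    intro hbr
    have := List.count_pos_iff.2 hbr
    simp [hab] at hb
    omega
  have m₁ : R ((c ++ b :: a :: (r₁ ++ [a])) ++ r₂ ++ b :: r₃)
      ((c ++ b :: a :: (r₁ ++ [a])) ++ b :: (r₂ ++ r₃)) :=
    hR.move_of_mem (by simp) hbr (by simpa using hz)
  have m₂ : R ((c ++ a :: b :: (r₁ ++ [a])) ++ r₂ ++ b :: r₃)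
      ((c ++ a :: b :: (r₁ ++ [a])) ++ b :: (r₂ ++ r₃)) := by
    refine hR.move_of_mem (by simp) hbr fun z hzr => (hz z hzr).trans (le_of_eq ?_)
    simp only [List.count_append, List.count_cons, List.count_nil]
    omega
  have s₁ : R ((c ++ b :: a :: r₁) ++ a :: b :: (r₂ ++ r₃))
      ((c ++ b :: a :: r₁) ++ b :: a :: (r₂ ++ r₃)) :=
    hR.swap_late (by simp) (by simp) hab
  have s₂ : R ((c ++ a :: b :: r₁) ++ b :: a :: (r₂ ++ r₃))
      ((c ++ a :: b :: r₁) ++ a :: b :: (r₂ ++ r₃)) :=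
    hR.swap_late (by simp) (by simp) hab.symm
  have k := hR.ctx c (r₂ ++ r₃) (hP [b] [a] r₁)
  simp only [List.append_assoc, List.cons_append, List.nil_append] at *
  exact hR.trans m₁ (hR.trans s₁ (hR.trans k (hR.trans s₂ (hR.symm m₂))))

lemma swap_parallel {T : Finset ℕ} {a b : ℕ} {c r : List ℕ}
    (hP : SwapsParallel R) (hab : a ≠ b) (h : SameBlocks T a b (c ++ b :: a :: r))
    (hT : ∀ z ∈ c ++ b :: a :: r, z ∈ T ↔ (c ++ b :: a :: r).count z = 1)
    (hb : (c ++ b :: a :: r).count b = 2) (ha : (c ++ b :: a :: r).count a = 2)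
    (har : a ∈ r) (hbr : b ∈ r) :
    R (c ++ b :: a :: r) (c ++ a :: b :: r) := by
  have perm : ∀ z, (c ++ b :: a :: r).count z = (c ++ a :: b :: r).count z := by
    intro z
    simp only [List.count_append, List.count_cons]
    omega
  obtain ⟨r₁, r', rfl⟩ := List.append_of_mem har
  rw [List.mem_append, List.mem_cons] at hbr
  rcases hbr with hbr | rfl | hbr
  · obtain ⟨s₁, s₂, rfl⟩ := List.append_of_mem hbr
    have h' : SameBlocks T b a (c ++ a :: b :: (s₁ ++ b :: (s₂ ++ a :: r'))) := by
      intro s hs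
      have hs1 : s ∈ c ++ b :: a :: ((s₁ ++ b :: s₂) ++ a :: r') → s ≠ a ∧ s ≠ b := by
        intro hm
        have := (hT s hm).1 hs
        constructor <;> rintro rfl <;> omega
      have hs2 : s ≠ a ∧ s ≠ b := by
        by_cases hm : s ∈ c ++ b :: a :: ((s₁ ++ b :: s₂) ++ a :: r')
        · exact hs1 hm
        · simp at hm; tauto
      have := h s hs
      have ha1 : a ∈ ({a, s} : Finset ℕ) := by simp
      have hb1 : b ∉ ({a, s} : Finset ℕ) := by simp [hab.symm, hs2.2.symm]
      have ha2 : a ∉ ({b, s} : Finset ℕ) := by simp [hab, hs2.1.symm]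
      have hb2 : b ∈ ({b, s} : Finset ℕ) := by simp
      simp only [proj_append, proj_cons_mem ha1, proj_cons_mem hb2, proj_cons_notMem hb1,
        proj_cons_notMem ha2, List.append_assoc, List.cons_append] at this ⊢
      exact this.symm
    have := hR.symm (hR.swap_parallel_aux (T := T) hP hab.symm h' (fun z hz => ?_) ?_ ?_)
    · simpa using this
    · rw [hT z (by simp [hz]), perm z]; simp
    · rw [← ha, perm a]; simp
    · rw [← hb, perm b]; simp
  · exact absurd rfl hab
  · obtain ⟨s₁, s₂, rfl⟩ := List.append_of_mem hbr
    exact hR.swap_parallel_aux hP hab h (fun z hz => hT z (by simp [hz])) hb ha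

end Admissible

lemma firstOf_append_of_mem {x y : ℕ} {c : List ℕ} (h : x ∈ c ∨ y ∈ c) (l : List ℕ) :
    firstOf x y (c ++ l) = firstOf x y c := by
  have : proj {x, y} c ≠ [] := by
    intro e
    have h1 : x ∉ proj {x, y} c := by simp [e]
    have h2 : y ∉ proj {x, y} c := by simp [e]
    simp only [mem_proj, Finset.mem_insert, Finset.mem_singleton, true_or, or_true,
      and_true] at h1 h2
    tauto
  rw [firstOf, firstOf, proj_append, List.head?_append_of_ne_nil _ this]

lemma firstOf_append_of_notMem {x y : ℕ} {c : List ℕ} (hx : x ∉ c) (hy : y ∉ c) (l : List ℕ) :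
    firstOf x y (c ++ l) = firstOf x y l := by
  rw [firstOf, firstOf, proj_append, proj_eq_nil, List.nil_append]
  intro a ha h
  simp only [Finset.mem_insert, Finset.mem_singleton] at h
  rcases h with rfl | rfl <;> contradiction

lemma firstOf_cons_left (x y : ℕ) (l : List ℕ) : firstOf x y (x :: l) = some x := by
  simp [firstOf, proj]

lemma firstOf_cons_right (x y : ℕ) (l : List ℕ) : firstOf x y (y :: l) = some y := by
  simp [firstOf, proj]

/-- Moving a letter to the front keeps projections which start with that letter anyway. -/
lemma proj_move_eq {S : Finset ℕ} {a : ℕ} {l p q : List ℕ} (ha : a ∉ p) (haS : a ∈ S)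
    (h : proj S (a :: l) = proj S (p ++ a :: q)) : proj S p = [] := by
  rw [proj_cons_mem haS, proj_append] at h
  rcases hp : proj S p with _ | ⟨b, w⟩
  · rfl
  · rw [hp, List.cons_append, List.cons.injEq] at h
    exact absurd (mem_proj.1 (show a ∈ proj S p by simp [hp, h.1])).1 ha

namespace Admissible

variable {R : List ℕ → List ℕ → Prop} (hR : Admissible R)
include hR

lemma swap_of_trace {T : Finset ℕ} {a b : ℕ} {c l p₁ p₂ q : List ℕ}
    (hT : ∀ z, z ∈ T ↔ (c ++ a :: l).count z = 1)
    (hc : ∀ z, (a :: l).count z = (p₁ ++ b :: p₂ ++ a :: q).count z)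
    (hP : ∀ t ∈ T, ∀ x, proj {t, x} (a :: l) = proj {t, x} (p₁ ++ b :: p₂ ++ a :: q))
    (ha : a ∉ p₁ ++ b :: p₂)
    (hp : ∀ x y, x ≠ y → (c ++ a :: l).count x = 2 → (c ++ a :: l).count y = 2 →
      firstOf x y (c ++ a :: l) = firstOf x y (c ++ (p₁ ++ b :: p₂ ++ a :: q)) ∨
        SwapsFirst R ∨ SwapsParallel R ∧ SameBlocks T x y (c ++ a :: l)) :
    R (c ++ p₁ ++ b :: a :: (p₂ ++ q)) (c ++ p₁ ++ a :: b :: (p₂ ++ q)) := by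
  have hab : a ≠ b := by rintro rfl; simp at ha
  have haT : a ∉ T := by
    intro h
    have := proj_move_eq (S := {a, b}) ha (by simp) (hP a h b)
    exact absurd (mem_proj.2 ⟨show b ∈ p₁ ++ b :: p₂ by simp, by simp⟩) (this ▸ List.not_mem_nil)
  have hbT : b ∉ T := by
    intro h
    have := proj_move_eq (S := {b, a}) ha (by simp) (hP b h a)
    exact absurd (mem_proj.2 ⟨show b ∈ p₁ ++ b :: p₂ by simp, by simp⟩) (this ▸ List.not_mem_nil)
  have hcW : ∀ z, (c ++ a :: l).count z = (c ++ p₁ ++ b :: a :: (p₂ ++ q)).count z := by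
    intro z
    rw [List.count_append, hc z]
    simp only [List.count_append, List.count_cons]
    omega
  have ha1 := (hT a).not.1 haT
  have hb1 := (hT b).not.1 hbT
  rw [hcW] at ha1 hb1
  by_cases h : 1 ≤ (c ++ p₁).count b ∨ 1 ≤ (c ++ p₁).count a ∨ 2 ≤ (p₂ ++ q).count b ∨
      2 ≤ (p₂ ++ q).count a
  · refine hR.swap hab.symm ?_ ?_ h <;>
    · simp only [List.count_append, List.count_cons, beq_self_eq_true, if_true, beq_iff_eq, hab,
        hab.symm, if_false] at ha1 hb1 ⊢
      omega
  have ha2 : (c ++ p₁ ++ b :: a :: (p₂ ++ q)).count a = 2 := by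
    simp only [List.count_append, List.count_cons, beq_self_eq_true, if_true, beq_iff_eq,
        hab.symm, if_false] at ha1 h ⊢
    omega
  have hb2 : (c ++ p₁ ++ b :: a :: (p₂ ++ q)).count b = 2 := by
    simp only [List.count_append, List.count_cons, beq_self_eq_true, if_true, beq_iff_eq, hab,
        if_false] at hb1 h ⊢
    omega
  have har : a ∈ p₂ ++ q := by
    refine List.count_pos_iff.1 ?_
    simp only [List.count_append, List.count_cons, beq_self_eq_true, if_true, beq_iff_eq,
        hab.symm, if_false] at ha2 h ⊢
    omega
  have hbr : b ∈ p₂ ++ q := by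
    refine List.count_pos_iff.1 ?_
    simp only [List.count_append, List.count_cons, beq_self_eq_true, if_true, beq_iff_eq, hab,
        if_false] at hb2 h ⊢
    omega
  have hac : a ∉ c := fun h' => h (by have := List.count_pos_iff.2 h'; simp; omega)
  have hbc : b ∉ c := fun h' => h (by have := List.count_pos_iff.2 h'; simp; omega)
  have hbp : b ∉ p₁ := fun h' => h (by have := List.count_pos_iff.2 h'; simp; omega)
  have hap : a ∉ p₁ := fun h' => ha (by simp [h'])
  rcases hp a b hab ((hcW a).trans ha2) ((hcW b).trans hb2) with h1 | h1 | ⟨h1, h2⟩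
  · rw [firstOf_append_of_notMem hac hbc, firstOf_append_of_notMem hac hbc, firstOf_cons_left,
      List.append_assoc, firstOf_append_of_notMem hap hbp, List.cons_append,
      firstOf_cons_right] at h1
    exact absurd (Option.some.inj h1) hab
  · obtain ⟨r₁, r₂, hr⟩ := List.append_of_mem har
    rw [hr, List.mem_append, List.mem_cons] at hbr
    rw [hr]
    rcases hbr with hbr | rfl | hbr
    · obtain ⟨s₁, s₂, rfl⟩ := List.append_of_mem hbr
      simpa using hR.ctx (c ++ p₁) r₂ (h1 [b] [a] s₁ s₂)
    · exact absurd rfl hab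
    · obtain ⟨s₁, s₂, rfl⟩ := List.append_of_mem hbr
      simpa using hR.symm (hR.ctx (c ++ p₁) s₂ (h1 [a] [b] r₁ s₁))
  · refine hR.swap_parallel (T := T) h1 hab ?_ (fun z _ => by rw [hT, hcW]) hb2 ha2 har hbr
    have key : ∀ s ∈ T, ∀ x, proj {x, s} (c ++ a :: l) =
        proj {x, s} (c ++ (p₁ ++ b :: p₂ ++ a :: q)) := by
      intro s hs x
      rw [proj_append, proj_append, Finset.pair_comm, hP s hs]
    intro s hs
    have hsa : s ≠ a := by rintro rfl; exact haT hs
    have hsb : s ≠ b := by rintro rfl; exact hbT hs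
    have e1 : proj {a, s} (p₁ ++ b :: p₂) = [] :=
      proj_move_eq ha (by simp) (by rw [Finset.pair_comm]; exact hP s hs a)
    have h3 := h2 s hs
    have m1 : a ∈ ({a, s} : Finset ℕ) := by simp
    have m2 : b ∉ ({a, s} : Finset ℕ) := by simp [hab.symm, hsb.symm]
    have m3 : a ∉ ({b, s} : Finset ℕ) := by simp [hab, hsa.symm]
    have m4 : b ∈ ({b, s} : Finset ℕ) := by simp
    rw [key s hs, key s hs] at h3
    rw [proj_append, proj_cons_notMem m2, List.append_eq_nil_iff] at e1
    simp only [proj_append, proj_cons_mem m1, proj_cons_mem m4, proj_cons_notMem m2,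
        proj_cons_notMem m3, List.append_assoc, List.cons_append, e1.1, e1.2,
        List.nil_append] at h3 ⊢
    exact h3

lemma trace {T : Finset ℕ} : ∀ (l₁ c l₂ : List ℕ),
    (∀ z, z ∈ T ↔ (c ++ l₁).count z = 1) → (∀ z, l₁.count z = l₂.count z) →
    (∀ t ∈ T, ∀ x, proj {t, x} l₁ = proj {t, x} l₂) →
    (∀ x y, x ≠ y → (c ++ l₁).count x = 2 → (c ++ l₁).count y = 2 →
      firstOf x y (c ++ l₁) = firstOf x y (c ++ l₂) ∨
        SwapsFirst R ∨ SwapsParallel R ∧ SameBlocks T x y (c ++ l₁)) →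
    R (c ++ l₁) (c ++ l₂)
  | [], c, l₂ => by
    intro _ hc _ _
    have : l₂ = [] := List.eq_nil_iff_forall_not_mem.2 fun z => by
      rw [← List.count_eq_zero, ← hc]; rfl
    rw [this]
    exact hR.refl _
  | a :: l, c, l₂ => by
    intro hT hc hP hp
    have hm : a ∈ l₂ := List.count_pos_iff.1 (by rw [← hc]; simp)
    obtain ⟨p, q, rfl, ha⟩ := List.eq_append_cons_of_mem hm
    have mv : R (c ++ p ++ a :: q) (c ++ a :: (p ++ q)) := by
      refine hR.move ?_
      rintro p₁ b p₂ rfl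
      exact hR.swap_of_trace hT hc hP ha hp
    have hP' : ∀ t ∈ T, ∀ x, proj {t, x} (a :: l) = proj {t, x} (a :: (p ++ q)) := by
      intro t ht x
      have h := hP t ht x
      by_cases hS : a ∈ ({t, x} : Finset ℕ)
      · have e := proj_move_eq ha hS h
        rw [h, proj_append, proj_cons_mem hS, proj_cons_mem hS, proj_append, e]
        rfl
      · rw [h, proj_append, proj_cons_notMem hS, proj_cons_notMem hS, proj_append]
    have ih := trace (T := T) l (c ++ [a]) (p ++ q) (by simpa using hT) (fun z => ?_)
      (fun t ht x => ?_) (fun x y hxy hx hy => ?_)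
    · exact hR.trans (by simpa using ih) (hR.symm (by simpa using mv))
    · have := hc z
      simp only [List.count_append, List.count_cons] at this ⊢
      omega
    · have h := hP' t ht x
      by_cases hS : a ∈ ({t, x} : Finset ℕ)
      · simpa [proj_cons_mem hS] using h
      · simpa [proj_cons_notMem hS] using h
    · simp only [List.append_assoc, List.cons_append, List.nil_append] at hx hy ⊢
      rcases hp x y hxy hx hy with h | h
      · left
        by_cases hxc : x ∈ c ∨ y ∈ c
        · rw [firstOf_append_of_mem hxc, firstOf_append_of_mem hxc]
        push Not at hxc
        rw [firstOf_append_of_notMem hxc.1 hxc.2, firstOf_append_of_notMem hxc.1 hxc.2] at h ⊢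
        by_cases hxa : x = a
        · subst hxa; rw [firstOf_cons_left, firstOf_cons_left]
        by_cases hya : y = a
        · subst hya; rw [firstOf_cons_right, firstOf_cons_right]
        have hS : a ∉ ({x, y} : Finset ℕ) := by simp [Ne.symm hxa, Ne.symm hya]
        rw [h, firstOf, firstOf, proj_append, proj_cons_notMem hS, proj_cons_notMem hS,
          proj_append]
      · exact Or.inr h

end Admissible

/-- Combinatorial conditions under which `u` and `v`, whose once occurring letters form `T`,
are related by `R`. -/
structure Compatible (R : List ℕ → List ℕ → Prop) (T : Finset ℕ) (u v : List ℕ) : Prop where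
  left : ∀ z, z ∈ T ↔ u.count z = 1
  right : ∀ z, z ∈ T ↔ v.count z = 1
  mem : ∀ z, z ∈ u ↔ z ∈ v
  simple : proj T u = proj T v
  position : ∀ x, 2 ≤ u.count x → 2 ≤ v.count x →
    proj (insert x T) u = proj (insert x T) v ∨ (Collapses R T x u ∧ Collapses R T x v)
  order : ∀ x y, x ≠ y → u.count x = 2 → v.count x = 2 → u.count y = 2 → v.count y = 2 →
    (HasSquare T x u ∧ HasSquare T x v) ∨ (HasSquare T y u ∧ HasSquare T y v) ∨
      firstOf x y u = firstOf x y v ∨ SwapsFirst R ∨ SwapsParallel R ∧ SameBlocks T x y u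

lemma Collapses.mono {R R' : List ℕ → List ℕ → Prop} {T : Finset ℕ} {x : ℕ} {u : List ℕ}
    (hG : ∀ k, Gathers R k → Gathers R' k) (h : Collapses R T x u) : Collapses R' T x u :=
  h.imp_right fun ⟨k, h1, h2, h3⟩ => ⟨k, h1, h2, hG k h3⟩

lemma Compatible.mono {R R' : List ℕ → List ℕ → Prop} {T : Finset ℕ} {u v : List ℕ}
    (hG : ∀ k, Gathers R k → Gathers R' k) (hF : SwapsFirst R → SwapsFirst R')
    (hP : SwapsParallel R → SwapsParallel R') (h : Compatible R T u v) : Compatible R' T u v where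
  __ := h
  position x hu hv := (h.position x hu hv).imp_right fun h => ⟨h.1.mono hG, h.2.mono hG⟩
  order x y hxy h1 h2 h3 h4 := by
    rcases h.order x y hxy h1 h2 h3 h4 with h | h | h | h | h
    · exact Or.inl h
    · exact Or.inr (Or.inl h)
    · exact Or.inr (Or.inr (Or.inl h))
    · exact Or.inr (Or.inr (Or.inr (Or.inl (hF h))))
    · exact Or.inr (Or.inr (Or.inr (Or.inr ⟨hP h.1, h.2⟩)))

namespace Admissible

variable {R : List ℕ → List ℕ → Prop} (hR : Admissible R)
include hR

lemma central_del {x y : ℕ} (hxy : x ≠ y) {u : List ℕ} (h : Central R y u) :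
    Central R y (_root_.del x u) := by
  have := hR.delete x h
  rw [Central, del_comm y x]
  simpa [_root_.del, hxy.symm] using this

lemma of_central {T : Finset ℕ} : ∀ (n : ℕ) (u v : List ℕ), u.length = n →
    (∀ z, z ∈ T ↔ u.count z = 1) → (∀ z, z ∈ T ↔ v.count z = 1) → (∀ z, z ∈ u ↔ z ∈ v) →
    proj T u = proj T v →
    (∀ x, 2 ≤ u.count x → 2 ≤ v.count x →
      proj (insert x T) u = proj (insert x T) v ∨ (Central R x u ∧ Central R x v)) →
    (∀ x y, x ≠ y → u.count x = 2 → v.count x = 2 → u.count y = 2 → v.count y = 2 →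
      (Central R x u ∧ Central R x v) ∨ (Central R y u ∧ Central R y v) ∨
      firstOf x y u = firstOf x y v ∨ SwapsFirst R ∨ SwapsParallel R ∧ SameBlocks T x y u) →
    R u v := by
  intro n
  induction n using Nat.strong_induction_on with
  | _ n ih =>
  intro u v hn hu hv hm hs hx hxy
  by_cases hc : ∃ x, 2 ≤ u.count x ∧ 2 ≤ v.count x ∧ Central R x u ∧ Central R x v
  · obtain ⟨x, h1, h2, h3, h4⟩ := hc
    have hxT : x ∉ T := fun h => by rw [hu] at h; omega
    have hins : ∀ y, y ≠ x → x ∉ insert y T := fun y hy h => by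
      rcases Finset.mem_insert.1 h with h | h
      exacts [hy h.symm, hxT h]
    have main : R (del x u) (del x v) := by
      refine ih _ ?_ (del x u) (del x v) rfl (fun z => ?_) (fun z => ?_) (fun z => ?_) ?_
        (fun y hy1 hy2 => ?_) (fun y z hyz hy1 hy2 hz1 hz2 => ?_)
      · rw [← hn]
        exact List.length_filter_lt_length_iff_exists.2
          ⟨x, List.count_pos_iff.1 (by omega), by simp⟩
      · rcases eq_or_ne z x with rfl | hz
        · simp [hxT, count_del_self]
        · rw [count_del_of_ne hz, hu]
      · rcases eq_or_ne z x with rfl | hz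
        · simp [hxT, count_del_self]
        · rw [count_del_of_ne hz, hv]
      · simp [del, hm]
      · rw [proj_del hxT, proj_del hxT, hs]
      · have hyx : y ≠ x := by rintro rfl; rw [count_del_self] at hy1; omega
        rw [count_del_of_ne hyx] at hy1 hy2
        rw [proj_del (hins y hyx), proj_del (hins y hyx)]
        exact (hx y hy1 hy2).imp_right fun h =>
          ⟨hR.central_del hyx.symm h.1, hR.central_del hyx.symm h.2⟩
      · have hyx : y ≠ x := by rintro rfl; rw [count_del_self] at hy1; omega
        have hzx : z ≠ x := by rintro rfl; rw [count_del_self] at hz1; omega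
        rw [count_del_of_ne hyx] at hy1 hy2
        rw [count_del_of_ne hzx] at hz1 hz2
        have hp : x ∉ ({y, z} : Finset ℕ) := by simp [hyx.symm, hzx.symm]
        rw [firstOf, firstOf, proj_del hp, proj_del hp]
        rcases hxy y z hyz hy1 hy2 hz1 hz2 with h | h | h | h | ⟨h, h'⟩
        · exact Or.inl ⟨hR.central_del hyx.symm h.1, hR.central_del hyx.symm h.2⟩
        · exact Or.inr (Or.inl ⟨hR.central_del hzx.symm h.1, hR.central_del hzx.symm h.2⟩)
        · exact Or.inr (Or.inr (Or.inl h))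
        · exact Or.inr (Or.inr (Or.inr (Or.inl h)))
        · refine Or.inr (Or.inr (Or.inr (Or.inr ⟨h, fun s hs => ?_⟩)))
          have hsx : s ≠ x := by rintro rfl; exact hxT hs
          rw [proj_del (by simp [hyx.symm, hsx.symm]), proj_del (by simp [hzx.symm, hsx.symm])]
          exact h' s hs
    exact hR.trans h3 (hR.trans (by simpa using hR.ctx [x, x] [] main) (hR.symm h4))
  · push Not at hc
    have hx' : ∀ x, 2 ≤ u.count x → 2 ≤ v.count x →
        proj (insert x T) u = proj (insert x T) v := fun x h1 h2 =>
      (hx x h1 h2).resolve_right fun h => hc x h1 h2 h.1 h.2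
    have htri : ∀ x, (x ∉ u ∧ x ∉ v) ∨ x ∈ T ∨ (2 ≤ u.count x ∧ 2 ≤ v.count x) := by
      intro x
      by_cases h : x ∈ u
      · by_cases hT : x ∈ T
        · exact Or.inr (Or.inl hT)
        · have h1 := List.count_pos_iff.2 h
          have h2 := List.count_pos_iff.2 ((hm x).1 h)
          have h3 := (hu x).not.1 hT
          have h4 := (hv x).not.1 hT
          exact Or.inr (Or.inr ⟨by omega, by omega⟩)
      · exact Or.inl ⟨h, fun h' => h ((hm x).2 h')⟩
    refine hR.trace (T := T) u [] v hu (fun z => ?_) (fun t ht x => ?_)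
      (fun x y hne h1 h2 => ?_)
    · rcases htri z with h | h | h
      · rw [List.count_eq_zero.2 h.1, List.count_eq_zero.2 h.2]
      · rw [(hu z).1 h, (hv z).1 h]
      · rw [← count_proj (Finset.mem_insert_self z T), hx' z h.1 h.2,
          count_proj (Finset.mem_insert_self z T)]
    · rcases htri x with h | h | h
      · have e : ∀ w, x ∉ w → proj {t, x} w = proj {t} w := fun w hw =>
          proj_congr fun a ha => by
            have : a ≠ x := by rintro rfl; exact hw ha
            simp [this]
        rw [e u h.1, e v h.2]
        exact proj_eq_of_subset (by simpa using ht) hs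
      · exact proj_eq_of_subset (by simp [Finset.insert_subset_iff, ht, h]) hs
      · exact proj_eq_of_subset (by simp [Finset.insert_subset_iff, ht]) (hx' x h.1 h.2)
    · simp only [List.nil_append] at h1 h2 ⊢
      have e : ∀ z, u.count z = 2 → v.count z = 2 := by
        intro z hz
        rcases htri z with h | h | h
        · rw [List.count_eq_zero.2 h.1] at hz; omega
        · rw [(hu z).1 h] at hz; omega
        · rw [← hz, ← count_proj (Finset.mem_insert_self z T), ← hx' z h.1 h.2,
            count_proj (Finset.mem_insert_self z T)]
      rcases hxy x y hne h1 (e x h1) h2 (e y h2) with h | h | h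
      · exact absurd h.2 (hc x h1.ge (e x h1).ge h.1)
      · exact absurd h.2 (hc y h2.ge (e y h2).ge h.1)
      · exact h

lemma of_compatible {T : Finset ℕ} {u v : List ℕ} (h : Compatible R T u v) : R u v := by
  have cu : ∀ x, Collapses R T x u → Central R x u := fun x =>
    hR.central_of_collapses fun a _ => h.left a
  have cv : ∀ x, Collapses R T x v → Central R x v := fun x =>
    hR.central_of_collapses fun a _ => h.right a
  refine hR.of_central _ u v rfl h.left h.right h.mem h.simple
    (fun x h1 h2 => (h.position x h1 h2).imp_right fun h => ⟨cu x h.1, cv x h.2⟩)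
    (fun x y hxy h1 h2 h3 h4 => ?_)
  rcases h.order x y hxy h1 h2 h3 h4 with h | h | h
  · exact Or.inl ⟨cu x (Or.inl h.1), cv x (Or.inl h.2)⟩
  · exact Or.inr (Or.inl ⟨cu y (Or.inl h.1), cv y (Or.inl h.2)⟩)
  · exact Or.inr (Or.inr h)

end Admissible

/-- The word `x t₁ x ⋯ tₖ x`. -/
def alt (x : ℕ) : List ℕ → List ℕ
  | [] => [x]
  | t :: ts => x :: t :: alt x ts

lemma alt_append_cons (x t : ℕ) (ks ls : List ℕ) :
    alt x (ks ++ t :: ls) = alt x ks ++ t :: alt x ls := by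
  induction ks with
  | nil => rfl
  | cons a ks ih => simp [alt, ih]

lemma count_alt_self (x : ℕ) (ks : List ℕ) :
    (alt x ks).count x = ks.length + 1 + ks.count x := by
  induction ks with
  | nil => simp [alt]
  | cons a ks ih =>
    simp only [alt, List.count_cons, List.length_cons, ih, beq_self_eq_true, if_true]
    omega

lemma del_alt {x : ℕ} {ks : List ℕ} (h : x ∉ ks) : del x (alt x ks) = ks := by
  induction ks with
  | nil => simp [alt, del]
  | cons a ks ih =>
    simp only [List.mem_cons, not_or] at h
    have := ih h.2
    rw [del] at this
    rw [alt, del, List.filter_cons_of_neg (by simp),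
      List.filter_cons_of_pos (by simp [Ne.symm h.1]),
      this]

lemma alt_flatMap (f : ℕ → List ℕ) (x : ℕ) (ks : List ℕ) :
    (alt x ks).flatMap f = interleave (f x) (ks.map f) := by
  induction ks with
  | nil => simp [alt, interleave]
  | cons a ks ih => simp [alt, interleave, ih]

lemma eq_alt_or_square (x : ℕ) : ∀ (r ks : List ℕ), del x r = ks → ks.length + 1 ≤ r.count x →
    r = alt x ks ∨ ∃ a b, r = a ++ x :: x :: b
  | [], _, _, h => by simp at h
  | [y], ks, e, h => by
    by_cases hy : y = x
    · subst hy
      simp [del] at e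
      subst e
      exact Or.inl rfl
    · simp [hy] at h
  | y :: z :: r, ks, e, h => by
    by_cases hy : y = x
    · subst hy
      by_cases hz : z = y
      · subst hz
        exact Or.inr ⟨[], r, rfl⟩
      · have e' : ks = z :: del y r := by rw [← e]; simp [del, hz]
        subst e'
        rcases eq_alt_or_square y r _ rfl (by simpa [hz] using h) with h' | ⟨a, b, h'⟩
        · exact Or.inl (by rw [alt, ← h'])
        · exact Or.inr ⟨y :: z :: a, b, by rw [h']; rfl⟩
    · have e' : ks = y :: del x (z :: r) := by rw [← e]; simp [del, hy]
      subst e'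
      rw [List.count_cons_of_ne hy, List.length_cons] at h
      rcases eq_alt_or_square x (z :: r) _ rfl (by omega) with h' | ⟨a, b, h'⟩
      · have := count_alt_self x (del x (z :: r))
        rw [← h', count_del_self] at this
        omega
      · exact Or.inr ⟨y :: a, b, by rw [h']; rfl⟩

lemma exists_alt_sublist {x : ℕ} : ∀ {r : List ℕ}, (¬ ∃ a b, r = a ++ x :: x :: b) → x ∈ r →
    ∃ ks, (alt x ks).Sublist r ∧ ks.length + 1 = r.count x
  | [], _, h => by simp at h
  | [y], _, h => by
    simp only [List.mem_singleton] at h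
    subst h
    exact ⟨[], by simp [alt]⟩
  | y :: z :: r, hs, h => by
    have hs' : ¬ ∃ a b, z :: r = a ++ x :: x :: b := by
      rintro ⟨a, b, e⟩
      exact hs ⟨y :: a, b, by rw [e]; rfl⟩
    have hs'' : ¬ ∃ a b, r = a ++ x :: x :: b := by
      rintro ⟨a, b, e⟩
      exact hs ⟨y :: z :: a, b, by rw [e]; rfl⟩
    by_cases hy : y = x
    · subst hy
      have hz : z ≠ y := by rintro rfl; exact hs ⟨[], r, rfl⟩
      by_cases hr : y ∈ r
      · obtain ⟨ks, h1, h2⟩ := exists_alt_sublist hs'' hr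
        exact ⟨z :: ks, (h1.cons_cons z).cons_cons y, by simp [hz, ← h2]⟩
      · exact ⟨[], by simp [alt], by simp [hz, List.count_eq_zero.2 hr]⟩
    · obtain ⟨ks, h1, h2⟩ := exists_alt_sublist hs' (by simpa [Ne.symm hy] using h)
      exact ⟨ks, h1.cons y, by rw [h2, List.count_cons_of_ne hy]⟩

lemma proj_toFinset_of_sublist {x : ℕ} {w r : List ℕ} (h : w.Sublist r)
    (hx : w.count x = r.count x) (hr : (del x r).Nodup) : proj w.toFinset r = w := by
  have h1 : proj w.toFinset w = w := List.filter_eq_self.2 (by simp)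
  have h2 : w.Sublist (proj w.toFinset r) := by
    conv_lhs => rw [← h1]
    exact h.filter _
  refine (h2.eq_of_length (List.Perm.length_eq (List.perm_iff_count.2 fun a => ?_))).symm
  by_cases ha : a ∈ w
  · rw [count_proj (by simpa using ha)]
    by_cases hax : a = x
    · rw [hax, hx]
    · have h3 := List.nodup_iff_count_le_one.1 hr a
      rw [count_del_of_ne hax] at h3
      have h4 := h.count_le a
      have h5 := List.count_pos_iff.2 ha
      omega
  · rw [List.count_eq_zero.2 ha, List.count_eq_zero.2]
    simp [mem_proj, ha]

lemma append_cons_left_inj {α : Type*} {t : α} {a b c d : List α} (h : a ++ t :: b = c ++ t :: d)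
    (ha : t ∉ a) (hc : t ∉ c) : a = c := by
  rw [List.append_eq_append_iff] at h
  rcases h with ⟨e, rfl, h⟩ | ⟨e, rfl, h⟩ <;> rcases e with _ | ⟨f, e⟩
  · simp
  · simp only [List.cons_append, List.cons.injEq] at h
    simp [h.1] at hc
  · simp
  · simp only [List.cons_append, List.cons.injEq] at h
    simp [h.1] at ha

/-- Some letter separating two occurrences of `x` in `u` has a different number of occurrences
of `x` before it in `v`. -/
def Displaced (x : ℕ) (u v : List ℕ) : Prop :=
  ∃ t p₁ p₂ q₁ q₂, t ≠ x ∧ u = p₁ ++ t :: p₂ ∧ v = q₁ ++ t :: q₂ ∧ x ∈ p₁ ∧ x ∈ p₂ ∧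
    p₁.count x ≠ q₁.count x

lemma displaced_of_append {x t : ℕ} {c q q' : List ℕ} (hx : t ≠ x)
    (hs : ¬ ∃ a b, c ++ x :: q = a ++ x :: x :: b)
    (hc : (c ++ x :: q).count x = (c ++ t :: q').count x) (h2 : 2 ≤ (c ++ x :: q).count x)
    (hd : del x (x :: q) = del x (t :: q')) :
    Displaced x (c ++ x :: q) (c ++ t :: q') ∨ Displaced x (c ++ t :: q') (c ++ x :: q) := by
  simp only [List.count_append, List.count_cons_self, List.count_cons_of_ne hx] at hc h2
  have hd' : del x q = t :: del x q' := by simpa [del, hx] using hd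
  by_cases hxc : x ∈ c
  · have ht : t ∈ q := by
      have : t ∈ del x q := by simp [hd']
      exact (List.mem_filter.1 this).1
    obtain ⟨q₁, q₂, rfl⟩ := List.append_of_mem ht
    exact Or.inr ⟨t, c, q', c ++ x :: q₁, q₂, hx, rfl, by simp, hxc,
      List.count_pos_iff.1 (by omega), by simp⟩
  · rw [List.count_eq_zero.2 hxc] at h2
    obtain _ | ⟨a, q⟩ := q
    · simp [del] at hd'
    · have hax : a ≠ x := by rintro rfl; exact hs ⟨c, q, rfl⟩
      have hat : a = t := by
        have : a :: del x q = t :: del x q' := by rw [← hd']; simp [del, hax]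
        simpa using congrArg List.head? this
      subst hat
      rw [List.count_cons_of_ne hx] at h2
      exact Or.inl ⟨a, c ++ [x], q, c, q', hx, by simp, rfl, by simp,
        List.count_pos_iff.1 (by omega), by simp⟩

lemma displaced_of_ne {x : ℕ} : ∀ (r r' c : List ℕ),
    (¬ ∃ a b, c ++ r = a ++ x :: x :: b) → (¬ ∃ a b, c ++ r' = a ++ x :: x :: b) →
    (c ++ r).count x = (c ++ r').count x → 2 ≤ (c ++ r).count x → del x r = del x r' →
    r ≠ r' → Displaced x (c ++ r) (c ++ r') ∨ Displaced x (c ++ r') (c ++ r)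
  | [], [], _, _, _, _, _, _, h => absurd rfl h
  | [], b :: r', c, _, _, hc, _, hd, _ => by
    by_cases hb : b = x
    · simp [hb] at hc
    · simp [del, hb] at hd
  | a :: r, [], c, _, _, hc, _, hd, _ => by
    by_cases ha : a = x
    · simp [ha] at hc
    · simp [del, ha] at hd
  | a :: r, b :: r', c, hs, hs', hc, h2, hd, hne => by
    by_cases hab : a = b
    · subst hab
      have hd' : del x r = del x r' := by
        by_cases ha : a = x
        · simpa [del, ha] using hd
        · simpa [del, ha] using hd
      have := displaced_of_ne r r' (c ++ [a]) (by simpa using hs) (by simpa using hs')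
        (by simpa using hc) (by simpa using h2) hd' (by rintro rfl; exact hne rfl)
      simpa using this
    · by_cases ha : a = x
      · subst ha
        exact displaced_of_append (Ne.symm hab) hs hc h2 hd
      · by_cases hb : b = x
        · subst hb
          exact (displaced_of_append hab hs' hc.symm (hc ▸ h2) hd.symm).symm
        · exact absurd (by simpa [del, ha, hb] using congrArg List.head? hd) hab

namespace Admissible

variable {R : List ℕ → List ℕ → Prop} (hR : Admissible R)
include hR

lemma gathers_of_alt {x : ℕ} {ks : List ℕ} (hx : x ∉ ks) (hk : ks.Nodup)
    (h : R (alt x ks) (x :: x :: ks)) : Gathers R ks.length := by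
  intro X ps hl
  set f : ℕ → List ℕ := fun a => if a = x then X else ps.getD (ks.idxOf a) [] with hf
  have h1 : ks.map f = ps := by
    refine List.ext_getElem (by simp [hl]) fun i h1 h2 => ?_
    simp only [List.length_map] at h1
    have h3 : ks[i] ≠ x := fun e => hx (e ▸ List.getElem_mem h1)
    simp only [List.getElem_map, hf]
    simp [h3, hk.idxOf_getElem, h2]
  have h2 : f x = X := by simp [hf]
  have h3 := hR.subst f h
  rw [alt_flatMap, h1, h2] at h3
  have h4 : (x :: x :: ks).flatMap f = X ++ X ++ ps.flatten := by
    rw [← h1]; simp [h2, List.flatMap_def]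
  rwa [h4] at h3

lemma gathers_of_ne {x : ℕ} {ks r : List ℕ} (hx : x ∉ ks) (hk : ks.Nodup) (hd : del x r = ks)
    (hc : ks.length + 1 ≤ r.count x) (hne : r ≠ alt x ks) (h : R (alt x ks) r) :
    Gathers R ks.length := by
  obtain ⟨a, b, rfl⟩ := (eq_alt_or_square x r ks hd hc).resolve_left hne
  refine hR.gathers_of_alt hx hk ?_
  have := hR.square_central h
  have e : del x (a ++ b) = ks := by rw [← hd]; simp [del]
  rwa [e] at this

lemma gathers_of_sublist {x : ℕ} {ks u v : List ℕ} (hs : (alt x ks).Sublist u)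
    (hl : ks.length + 1 = u.count x) (hn : (del x u).Nodup) (hd : del x u = del x v)
    (hc : u.count x ≤ v.count x) (hne : proj (alt x ks).toFinset v ≠ alt x ks) (h : R u v) :
    Gathers R ks.length := by
  have h0 : ks.count x = 0 := by
    have := hs.count_le x
    rw [count_alt_self] at this
    omega
  have hx : x ∉ ks := List.count_eq_zero.1 h0
  have hu := proj_toFinset_of_sublist hs (by rw [count_alt_self, h0, ← hl]) hn
  have hxS : x ∈ (alt x ks).toFinset := by
    have := count_alt_self x ks
    exact List.mem_toFinset.2 (List.count_pos_iff.1 (by omega))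
  have hdel : del x (proj (alt x ks).toFinset v) = ks := by
    have e : ∀ w, del x (proj (alt x ks).toFinset w) = proj (alt x ks).toFinset (del x w) :=
      fun w => List.filter_comm ..
    rw [e, ← hd, ← e, hu, del_alt hx]
  refine hR.gathers_of_ne (r := proj (alt x ks).toFinset v) hx ?_ hdel ?_ hne ?_
  · have := hs.filter (· ≠ x)
    rw [show (alt x ks).filter (· ≠ x) = ks from del_alt hx] at this
    exact hn.sublist this
  · rw [count_proj hxS]; omega
  · have := hR.project (alt x ks).toFinset h
    rwa [hu] at this

lemma gathers_of_displaced {x : ℕ} {u v : List ℕ} (hs : ¬ ∃ a b, u = a ++ x :: x :: b)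
    (hn : (del x u).Nodup) (hd : del x u = del x v) (hc : u.count x ≤ v.count x)
    (h : R u v) (hD : Displaced x u v) : ∃ k, k + 1 = u.count x ∧ Gathers R k := by
  obtain ⟨t, p₁, p₂, q₁, q₂, htx, rfl, rfl, h1, h2, hne⟩ := hD
  obtain ⟨ks, k1, k2⟩ := exists_alt_sublist (r := p₁)
    (fun ⟨a, b, e⟩ => hs ⟨a, b ++ t :: p₂, by simp [e]⟩) h1
  obtain ⟨ls, l1, l2⟩ := exists_alt_sublist (r := p₂)
    (fun ⟨a, b, e⟩ => hs ⟨p₁ ++ t :: a, b, by simp [e]⟩) h2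
  have hsub : (alt x (ks ++ t :: ls)).Sublist (p₁ ++ t :: p₂) := by
    rw [alt_append_cons]
    exact k1.append (l1.cons_cons t)
  have hlen : (ks ++ t :: ls).length + 1 = (p₁ ++ t :: p₂).count x := by
    simp only [List.length_append, List.length_cons, List.count_append, List.count_cons_of_ne htx]
    omega
  refine ⟨_, hlen, hR.gathers_of_sublist hsub hlen hn hd hc ?_ h⟩
  have hmem : ∀ a b : List ℕ, (del x (a ++ t :: b)).Nodup → t ∉ a := by
    intro a b hab hta
    rw [del_append, List.nodup_append] at hab
    exact hab.2.2 t (by simp [del, hta, htx]) t (by simp [del, htx]) rfl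
  intro e
  have htS : t ∈ (alt x (ks ++ t :: ls)).toFinset := by simp [alt_append_cons]
  have hxS : x ∈ (alt x (ks ++ t :: ls)).toFinset :=
    List.mem_toFinset.2 (List.count_pos_iff.1 (by rw [count_alt_self]; omega))
  rw [proj_append, proj_cons_mem htS] at e
  set S := (alt x (ks ++ t :: ls)).toFinset
  rw [alt_append_cons] at e
  have e2 := append_cons_left_inj e (fun hm => hmem q₁ q₂ (hd ▸ hn) (mem_proj.1 hm).1)
    (fun hm => hmem p₁ p₂ hn (k1.mem hm))
  have h3 := k1.count_le x
  have h4 := count_alt_self x ks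
  apply hne
  rw [← count_proj hxS q₁, e2]
  omega

/-- Related words in which the letters other than `x` are simple either agree or determine an
identity that makes `x` central. -/
lemma eq_or_gathers {x : ℕ} {u v : List ℕ} (hn : (del x u).Nodup) (hd : del x u = del x v)
    (hu : 2 ≤ u.count x) (hv : 2 ≤ v.count x) (h : R u v) :
    u = v ∨
      (((∃ a b, u = a ++ x :: x :: b) ∨ ∃ k, 1 ≤ k ∧ k + 1 ≤ u.count x ∧ Gathers R k) ∧
      ((∃ a b, v = a ++ x :: x :: b) ∨ ∃ k, 1 ≤ k ∧ k + 1 ≤ v.count x ∧ Gathers R k)) := by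
  have square : ∀ {u v : List ℕ}, (del x u).Nodup → del x u = del x v → 2 ≤ u.count x →
      R u v → (∃ a b, v = a ++ x :: x :: b) → (¬ ∃ a b, u = a ++ x :: x :: b) →
      ∃ k, 1 ≤ k ∧ k + 1 ≤ u.count x ∧ Gathers R k := by
    rintro u _ hn hd hu h ⟨a, b, rfl⟩ hs
    obtain ⟨ks, k1, k2⟩ := exists_alt_sublist hs (List.count_pos_iff.1 (by omega))
    refine ⟨ks.length, by omega, k2.le, ?_⟩
    have h0 : ks.count x = 0 := by
      have := k1.count_le x
      rw [count_alt_self] at this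
      omega
    have hx : x ∉ ks := List.count_eq_zero.1 h0
    have hp := proj_toFinset_of_sublist k1 (by rw [count_alt_self, h0, ← k2]) hn
    have hxS : x ∈ (alt x ks).toFinset :=
      List.mem_toFinset.2 (List.count_pos_iff.1 (by rw [count_alt_self]; omega))
    have e : ∀ w, del x (proj (alt x ks).toFinset w) = proj (alt x ks).toFinset (del x w) :=
      fun w => List.filter_comm ..
    refine hR.gathers_of_alt hx ?_ ?_
    · have := k1.filter (· ≠ x)
      rw [show (alt x ks).filter (· ≠ x) = ks from del_alt hx] at this
      exact hn.sublist this
    · have h1 := hR.project (alt x ks).toFinset (hR.square_central h)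
      have h2 : del x (a ++ b) = del x (a ++ x :: x :: b) := by simp [del]
      rw [hp, h2, ← hd, proj_cons_mem hxS, proj_cons_mem hxS, ← e, hp, del_alt hx] at h1
      exact h1
  have apart : ∀ {u v : List ℕ}, (del x u).Nodup → del x u = del x v → 2 ≤ u.count x →
      R u v → (¬ ∃ a b, u = a ++ x :: x :: b) → u.count x < v.count x →
      ∃ k, 1 ≤ k ∧ k + 1 ≤ u.count x ∧ Gathers R k := by
    intro u v hn hd hu h hs hlt
    obtain ⟨ks, k1, k2⟩ := exists_alt_sublist hs (List.count_pos_iff.1 (by omega))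
    refine ⟨ks.length, by omega, k2.le, hR.gathers_of_sublist k1 k2 hn hd hlt.le (fun e => ?_) h⟩
    have hxS : x ∈ (alt x ks).toFinset :=
      List.mem_toFinset.2 (List.count_pos_iff.1 (by rw [count_alt_self]; omega))
    have h1 := count_proj hxS v
    rw [e] at h1
    have := k1.count_le x
    omega
  by_cases su : ∃ a b, u = a ++ x :: x :: b
  · by_cases sv : ∃ a b, v = a ++ x :: x :: b
    · exact Or.inr ⟨Or.inl su, Or.inl sv⟩
    · exact Or.inr ⟨Or.inl su, Or.inr (square (hd ▸ hn) hd.symm hv (hR.symm h) su sv)⟩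
  · by_cases sv : ∃ a b, v = a ++ x :: x :: b
    · exact Or.inr ⟨Or.inr (square hn hd hu h sv su), Or.inl sv⟩
    · by_cases e : u = v
      · exact Or.inl e
      · refine Or.inr ?_
        rcases lt_trichotomy (u.count x) (v.count x) with hlt | heq | hlt
        · obtain ⟨k, h1, h2, h3⟩ := apart hn hd hu h su hlt
          exact ⟨Or.inr ⟨k, h1, h2, h3⟩, Or.inr ⟨k, h1, by omega, h3⟩⟩
        · have : ∃ k, k + 1 = u.count x ∧ Gathers R k := by
            rcases displaced_of_ne u v [] su sv heq hu hd e with hD | hD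
            · exact hR.gathers_of_displaced su hn hd heq.le h hD
            · obtain ⟨k, h1, h2⟩ := hR.gathers_of_displaced sv (hd ▸ hn) hd.symm heq.ge
                (hR.symm h) hD
              exact ⟨k, by omega, h2⟩
          obtain ⟨k, h1, h2⟩ := this
          exact ⟨Or.inr ⟨k, by omega, by omega, h2⟩, Or.inr ⟨k, by omega, by omega, h2⟩⟩
        · obtain ⟨k, h1, h2, h3⟩ := apart (hd ▸ hn) hd.symm hv (hR.symm h) sv hlt
          exact ⟨Or.inr ⟨k, h1, by omega, h3⟩, Or.inr ⟨k, h1, h2, h3⟩⟩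

lemma position_of_rel {T : Finset ℕ} {x : ℕ} {u v : List ℕ} (hu : ∀ z, z ∈ T ↔ u.count z = 1)
    (hs : proj T u = proj T v) (hxu : 2 ≤ u.count x) (hxv : 2 ≤ v.count x) (h : R u v) :
    proj (insert x T) u = proj (insert x T) v ∨ (Collapses R T x u ∧ Collapses R T x v) := by
  have hxT : x ∉ T := fun h => by rw [hu] at h; omega
  have hd : ∀ w, del x (proj (insert x T) w) = proj T w := by
    intro w
    simp only [del, proj, List.filter_filter]
    refine List.filter_congr fun a _ => ?_
    by_cases ha : a = x
    · simp [ha, hxT]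
    · simp [ha]
  have hc : ∀ w, (proj (insert x T) w).count x = w.count x :=
    count_proj (Finset.mem_insert_self x T)
  have hn : (proj T u).Nodup := by
    rw [List.nodup_iff_count_le_one]
    intro a
    by_cases ha : a ∈ T
    · rw [count_proj ha, (hu a).1 ha]
    · rw [List.count_eq_zero.2 (by simp [mem_proj, ha])]
      omega
  have := hR.eq_or_gathers (x := x) (by rw [hd]; exact hn) (by rw [hd, hd, hs]) (by rwa [hc])
    (by rwa [hc]) (hR.project (insert x T) h)
  simp only [hc] at this
  exact this

end Admissible

lemma exists_split_of_count_eq_one {s : ℕ} {w : List ℕ} (h : w.count s = 1) :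
    ∃ a b, w = a ++ s :: b ∧ s ∉ a ∧ s ∉ b := by
  obtain ⟨a, b, rfl⟩ := List.append_of_mem (List.count_pos_iff.1 (show 0 < w.count s by omega))
  rw [List.count_append, List.count_cons_self] at h
  exact ⟨a, b, rfl, List.count_eq_zero.1 (by omega), List.count_eq_zero.1 (by omega)⟩

lemma exists_separator {T : Finset ℕ} {y : ℕ} {u : List ℕ} (hy : u.count y = 2)
    (h : ¬ HasSquare T y u) :
    ∃ s ∈ T, ∃ e f, u = e ++ s :: f ∧ e.count y = 1 ∧ f.count y = 1 := by
  obtain ⟨p, q, r, rfl⟩ := exists_split_of_two_le_count hy.ge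
  simp only [List.count_append, List.count_cons_self] at hy
  by_contra! hs
  refine h ⟨proj (insert y T) p, proj (insert y T) r, ?_⟩
  have hq : proj (insert y T) q = [] := by
    refine proj_eq_nil fun a ha haT => ?_
    rcases Finset.mem_insert.1 haT with rfl | haT
    · have := List.count_pos_iff.2 ha; omega
    · obtain ⟨q₁, q₂, rfl⟩ := List.append_of_mem ha
      by_cases hay : a = y
      · simp [hay] at hy; omega
      rw [List.count_append, List.count_cons_of_ne hay] at hy
      refine hs a haT (p ++ y :: q₁) (q₂ ++ y :: r) (by simp) ?_ ?_ <;>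
        simp only [List.count_append, List.count_cons_self] <;> omega
  have hyS : y ∈ insert y T := Finset.mem_insert_self y T
  simp [proj_append, proj_cons_mem hyS, hq]

lemma count_eq_of_proj_eq {x s : ℕ} {a b c d : List ℕ} (ha : s ∉ a) (hc : s ∉ c)
    (h : proj {x, s} (a ++ s :: b) = proj {x, s} (c ++ s :: d)) : a.count x = c.count x := by
  have hs : s ∈ ({x, s} : Finset ℕ) := by simp
  have hx : x ∈ ({x, s} : Finset ℕ) := by simp
  rw [proj_append, proj_append, proj_cons_mem hs, proj_cons_mem hs] at h
  rw [← count_proj hx a, ← count_proj hx c,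
    append_cons_left_inj h (fun h => ha (mem_proj.1 h).1) (fun h => hc (mem_proj.1 h).1)]

lemma map_proj_eq_replicate {x s : ℕ} (hx : x ≠ s) : ∀ {a : List ℕ}, s ∉ a →
    (proj {x, s} a).map (· == s) = List.replicate (a.count x) false
  | [], _ => rfl
  | b :: a, h => by
    simp only [List.mem_cons, not_or] at h
    by_cases hb : b = x
    · subst hb
      rw [proj_cons_mem (by simp), List.map_cons, map_proj_eq_replicate hx h.2,
        List.count_cons_self, List.replicate_succ]
      simp [hx]
    · rw [proj_cons_notMem (by simp [hb, Ne.symm h.1]), map_proj_eq_replicate hx h.2,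
        List.count_cons_of_ne hb]

lemma map_proj_split {x s : ℕ} (hx : x ≠ s) {a b : List ℕ} (ha : s ∉ a) (hb : s ∉ b) :
    (proj {x, s} (a ++ s :: b)).map (· == s) =
      List.replicate (a.count x) false ++ true :: List.replicate (b.count x) false := by
  rw [proj_append, proj_cons_mem (by simp), List.map_append, List.map_cons,
    map_proj_eq_replicate hx ha, map_proj_eq_replicate hx hb]
  simp

lemma eq_pair_of_count {x y : ℕ} (hxy : x ≠ y) {l : List ℕ} (hl : ∀ a ∈ l, a = x ∨ a = y)
    (hx : l.count x = 1) (hy : l.count y = 1) : l = [x, y] ∨ l = [y, x] := by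
  obtain ⟨a, b, rfl, ha, hb⟩ := exists_split_of_count_eq_one hx
  rw [List.count_append, List.count_cons_of_ne hxy] at hy
  have e : ∀ w : List ℕ, (∀ z ∈ w, z = y) → w = List.replicate (w.count y) y := by
    intro w hw
    have : w = List.replicate w.length y := List.eq_replicate_of_mem hw
    conv_lhs => rw [this]
    rw [List.count_eq_length.2 fun z hz => (hw z hz).symm]
  have ha' := e a fun z hz => (hl z (by simp [hz])).resolve_left (by rintro rfl; exact ha hz)
  have hb' := e b fun z hz => (hl z (by simp [hz])).resolve_left (by rintro rfl; exact hb hz)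
  rcases Nat.eq_zero_or_pos (a.count y) with h0 | h0
  · rw [h0] at ha'
    rw [show b.count y = 1 by omega] at hb'
    left; rw [ha', hb']; rfl
  · rw [show a.count y = 1 by omega] at ha'
    rw [show b.count y = 0 by omega] at hb'
    right; rw [ha', hb']; rfl

lemma eq_singleton_of_count {x : ℕ} {l : List ℕ} (hl : ∀ a ∈ l, a = x) (hx : l.count x = 1) :
    l = [x] := by
  have := List.eq_replicate_of_mem hl
  rw [this] at hx
  rw [List.count_replicate_self] at hx
  rw [this, hx]; rfl

lemma firstOf_proj {x y : ℕ} {S : Finset ℕ} (hx : x ∈ S) (hy : y ∈ S) (u : List ℕ) :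
    firstOf x y (proj S u) = firstOf x y u := by
  rw [firstOf, proj_proj (by simp [Finset.insert_subset_iff, hx, hy]), firstOf]

lemma mem_of_firstOf {x y : ℕ} {a b : List ℕ} (h : firstOf x y (a ++ b) = some x) (hy : y ∈ a) :
    x ∈ a := by
  rw [firstOf_append_of_mem (Or.inr hy)] at h
  exact (mem_proj.1 (List.mem_of_mem_head? h)).1

lemma firstOf_comm (x y : ℕ) (u : List ℕ) : firstOf x y u = firstOf y x u := by
  rw [firstOf, firstOf, Finset.pair_comm]

lemma proj_eq_pair {S : Finset ℕ} {x y : ℕ} {a : List ℕ} (hxy : x ≠ y) (hx : x ∈ S) (hy : y ∈ S)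
    (hS : ∀ z ∈ S, z ∈ a → z = x ∨ z = y) (hxa : a.count x = 1) (hya : a.count y = 1) :
    proj S a = [x, y] ∨ proj S a = [y, x] :=
  eq_pair_of_count hxy (fun z hz => hS z (mem_proj.1 hz).2 (mem_proj.1 hz).1)
    (by rw [count_proj hx, hxa]) (by rw [count_proj hy, hya])

lemma proj_three {x y s : ℕ} {a b : List ℕ} (hxy : x ≠ y) (ha : s ∉ a) (hb : s ∉ b)
    (hxa : a.count x = 1) (hya : a.count y = 1) (hxb : b.count x = 1) (hyb : b.count y = 1)
    (hf : firstOf x y (a ++ s :: b) = some x) :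
    ∃ q, (q = [x, y] ∨ q = [y, x]) ∧ proj {x, y, s} (a ++ s :: b) = x :: y :: s :: q := by
  have hx : x ∈ ({x, y, s} : Finset ℕ) := by simp
  have hy : y ∈ ({x, y, s} : Finset ℕ) := by simp
  have hs : s ∈ ({x, y, s} : Finset ℕ) := by simp
  have hS : ∀ w : List ℕ, s ∉ w → ∀ z ∈ ({x, y, s} : Finset ℕ), z ∈ w → z = x ∨ z = y := by
    intro w hw z hz hzw
    simp only [Finset.mem_insert, Finset.mem_singleton] at hz
    rcases hz with h | h | rfl
    exacts [Or.inl h, Or.inr h, absurd hzw hw]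
  refine ⟨_, proj_eq_pair hxy hx hy (hS b hb) hxb hyb, ?_⟩
  rw [← firstOf_proj hx hy] at hf
  rw [proj_append, proj_cons_mem hs] at hf ⊢
  rcases proj_eq_pair hxy hx hy (hS a ha) hxa hya with h | h
  · rw [h]; rfl
  · rw [h, List.cons_append, firstOf_cons_right] at hf
    exact absurd (Option.some.inj hf).symm hxy

lemma proj_four {x y s t : ℕ} {w e f c d : List ℕ} (hxy : x ≠ y) (hw : w = e ++ s :: f)
    (hw' : w = c ++ t :: d) (hs : w.count s = 1) (ht : w.count t = 1) (hx : w.count x = 2)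
    (hy : w.count y = 2) (hxe : e.count x = 1) (hye : e.count y = 1) (hxc : c.count x = 1)
    (hyc : c.count y = 2) :
    ∃ p, (p = [x, y] ∨ p = [y, x]) ∧ proj {x, y, s, t} w = p ++ [s, y, t, x] := by
  have hsx : s ≠ x := by rintro rfl; omega
  have hsy : s ≠ y := by rintro rfl; omega
  have htx : t ≠ x := by rintro rfl; omega
  have hty : t ≠ y := by rintro rfl; omega
  have hg : ∃ g, c = e ++ s :: g ∧ f = g ++ t :: d := by
    rw [hw, List.append_eq_append_iff] at hw'
    rcases hw' with ⟨g, rfl, h⟩ | ⟨g, rfl, h⟩ <;> rcases g with _ | ⟨z, g⟩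
    · simp at hyc; omega
    · simp only [List.cons_append, List.cons.injEq] at h
      exact ⟨g, by rw [h.1], h.2⟩
    · simp at hye; omega
    · rw [List.count_append] at hye; omega
  obtain ⟨g, rfl, rfl⟩ := hg
  subst hw
  have hst : s ≠ t := by rintro rfl; simp at hs; omega
  simp only [List.count_append, List.count_cons_self, List.count_cons_of_ne hsx,
    List.count_cons_of_ne hsy, List.count_cons_of_ne htx, List.count_cons_of_ne hty,
    List.count_cons_of_ne hst, List.count_cons_of_ne hst.symm] at *
  have hxS : x ∈ ({x, y, s, t} : Finset ℕ) := by simp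
  have hyS : y ∈ ({x, y, s, t} : Finset ℕ) := by simp
  have hsS : s ∈ ({x, y, s, t} : Finset ℕ) := by simp
  have htS : t ∈ ({x, y, s, t} : Finset ℕ) := by simp
  have hS : ∀ v : List ℕ, v.count s = 0 → v.count t = 0 →
      ∀ z ∈ ({x, y, s, t} : Finset ℕ), z ∈ v → z = x ∨ z = y := by
    intro v h1 h2 z hz hzv
    simp only [Finset.mem_insert, Finset.mem_singleton] at hz
    rcases hz with h | h | rfl | rfl
    exacts [Or.inl h, Or.inr h, absurd hzv (List.count_eq_zero.1 h1),
      absurd hzv (List.count_eq_zero.1 h2)]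
  refine ⟨_, proj_eq_pair hxy hxS hyS (hS e (by omega) (by omega)) hxe hye, ?_⟩
  have h1 : proj {x, y, s, t} g = [y] := by
    refine eq_singleton_of_count (fun z hz => ?_) (by rw [count_proj hyS]; omega)
    have h2 := mem_proj.1 hz
    refine (hS g (by omega) (by omega) z h2.2 h2.1).resolve_left ?_
    rintro rfl
    have := List.count_pos_iff.2 h2.1
    omega
  have h2 : proj {x, y, s, t} d = [x] := by
    refine eq_singleton_of_count (fun z hz => ?_) (by rw [count_proj hxS]; omega)
    have h2 := mem_proj.1 hz
    refine (hS d (by omega) (by omega) z h2.2 h2.1).resolve_right ?_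
    rintro rfl
    have := List.count_pos_iff.2 h2.1
    omega
  simp [proj_append, proj_cons_mem hsS, proj_cons_mem htS, h1, h2]

namespace Admissible

variable {R : List ℕ → List ℕ → Prop} (hR : Admissible R)
include hR

lemma swapsParallel_of_letters {x y s : ℕ} (hxy : x ≠ y) (hsx : s ≠ x) (hsy : s ≠ y)
    {q q' : List ℕ} (hq : q = [x, y] ∨ q = [y, x]) (hq' : q' = [x, y] ∨ q' = [y, x])
    (h : R (x :: y :: s :: q) (y :: x :: s :: q')) : SwapsParallel R := by
  intro X Y S
  have fix : ∀ (p q : List ℕ), (q = [x, y] ∨ q = [y, x]) → x ∈ p → y ∈ p →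
      R (p ++ q) (p ++ [x, y]) := by
    rintro p _ (rfl | rfl) h1 h2
    · exact hR.refl _
    · exact hR.swap_late h2 h1 hxy.symm
  have h1 := hR.trans (hR.symm (fix [x, y, s] q hq (by simp) (by simp)))
    (hR.trans h (fix [y, x, s] q' hq' (by simp) (by simp)))
  have := hR.subst (fun a => if a = x then X else if a = y then Y else S) h1
  simpa [hxy, hxy.symm, hsx, hsy] using this

lemma swapsFirst_of_letters {x y s t : ℕ} (hxy : x ≠ y) (hsx : s ≠ x) (hsy : s ≠ y)
    (htx : t ≠ x) (hty : t ≠ y) (hst : s ≠ t)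
    (h : R [x, y, s, y, t, x] [y, x, s, y, t, x]) : SwapsFirst R := by
  intro X Y S T
  have := hR.symm (hR.subst (fun a => if a = y then X else if a = x then Y else
    if a = s then S else T) h)
  simpa [hxy, hxy.symm, hsx, hsy, htx, hty, hst, hst.symm] using this

lemma swapsFirst_of_blocks {T : Finset ℕ} {x y t : ℕ} {u v a b c d : List ℕ} (hxy : x ≠ y)
    (hu : ∀ z, z ∈ T ↔ u.count z = 1) (hv : ∀ z, z ∈ T ↔ v.count z = 1)
    (hxu : u.count x = 2) (hyu : u.count y = 2) (hxv : v.count x = 2) (hyv : v.count y = 2)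
    (hy : ¬ HasSquare T y u) (px : proj (insert x T) u = proj (insert x T) v)
    (py : proj (insert y T) u = proj (insert y T) v)
    (fu : firstOf x y u = some x) (fv : firstOf x y v = some y) (ht : t ∈ T)
    (eu : u = a ++ t :: b) (ev : v = c ++ t :: d) (hxa : a.count x = 1) (hya : a.count y = 2)
    (hxc : c.count x = 1) (hyc : c.count y = 2) (h : R u v) : SwapsFirst R := by
  obtain ⟨s, hs, e, f, eu', hye, hyf⟩ := exists_separator hyu hy
  have hsu := (hu s).1 hs
  have hsv := (hv s).1 hs
  obtain ⟨e', f', ev', he', hf'⟩ := exists_split_of_count_eq_one hsv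
  have hse : s ∉ e := by
    rw [eu', List.count_append, List.count_cons_self] at hsu
    exact List.count_eq_zero.1 (by omega)
  have hsx : s ≠ x := by rintro rfl; omega
  have hsy : s ≠ y := by rintro rfl; omega
  have htu := (hu t).1 ht
  have htx : t ≠ x := by rintro rfl; omega
  have hty : t ≠ y := by rintro rfl; omega
  have hst : s ≠ t := by
    rintro rfl
    have hsa : s ∉ a := by
      rw [eu, List.count_append, List.count_cons_self] at hsu
      exact List.count_eq_zero.1 (by omega)
    have := append_cons_left_inj (eu'.symm.trans eu) hse hsa
    subst this
    omega
  have hsub : ∀ z, ({z, s} : Finset ℕ) ⊆ insert z T := fun z => by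
    simp [Finset.insert_subset_iff, hs]
  have k1 := count_eq_of_proj_eq hse he' (by
    rw [← eu', ← ev']; exact proj_eq_of_subset (hsub x) px)
  have k2 := count_eq_of_proj_eq hse he' (by
    rw [← eu', ← ev']; exact proj_eq_of_subset (hsub y) py)
  have hxe0 : 1 ≤ e.count x :=
    List.count_pos_iff.2 (mem_of_firstOf (eu' ▸ fu) (List.count_pos_iff.1 (by omega)))
  have hxe : e.count x = 1 := by
    have : e.Sublist a := by
      rw [eu'] at eu
      rw [List.append_eq_append_iff] at eu
      rcases eu with ⟨g, rfl, -⟩ | ⟨g, rfl, -⟩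
      · simp
      · rw [List.count_append] at hye; omega
    have := this.count_le x
    omega
  obtain ⟨p, hp, ep⟩ := proj_four hxy eu' eu hsu htu hxu hyu hxe hye hxa hya
  obtain ⟨p', hp', ep'⟩ := proj_four hxy ev' ev hsv ((hv t).1 ht) hxv hyv (by omega) (by omega)
    hxc hyc
  have hxS : x ∈ ({x, y, s, t} : Finset ℕ) := by simp
  have hyS : y ∈ ({x, y, s, t} : Finset ℕ) := by simp
  have h := hR.project {x, y, s, t} h
  rw [← firstOf_proj hxS hyS, ep] at fu
  rw [← firstOf_proj hxS hyS, ep'] at fv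
  rw [ep, ep'] at h
  rcases hp with rfl | rfl
  · rcases hp' with rfl | rfl
    · rw [List.cons_append, firstOf_cons_left] at fv
      exact absurd (Option.some.inj fv) hxy
    · exact hR.swapsFirst_of_letters hxy hsx hsy htx hty hst h
  · rw [List.cons_append, firstOf_cons_right] at fu
    exact absurd (Option.some.inj fu).symm hxy

lemma order_of_rel_aux {T : Finset ℕ} {x y : ℕ} {u v : List ℕ} (hxy : x ≠ y)
    (hu : ∀ z, z ∈ T ↔ u.count z = 1) (hv : ∀ z, z ∈ T ↔ v.count z = 1)
    (hxu : u.count x = 2) (hyu : u.count y = 2) (hxv : v.count x = 2) (hyv : v.count y = 2)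
    (hx : ¬ HasSquare T x u) (hy : ¬ HasSquare T y u)
    (px : proj (insert x T) u = proj (insert x T) v)
    (py : proj (insert y T) u = proj (insert y T) v)
    (fu : firstOf x y u = some x) (fv : firstOf x y v = some y) (h : R u v) :
    SwapsFirst R ∨ SwapsParallel R ∧ SameBlocks T x y u := by
  have split : ∀ s ∈ T, ∃ a b c d, u = a ++ s :: b ∧ v = c ++ s :: d ∧ s ∉ a ∧ s ∉ b ∧ s ∉ c ∧
      s ∉ d ∧ s ≠ x ∧ s ≠ y ∧ a.count x + b.count x = 2 ∧ a.count y + b.count y = 2 ∧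
      a.count x = c.count x ∧ a.count y = c.count y ∧ c.count x + d.count x = 2 ∧
      c.count y + d.count y = 2 := by
    intro s hs
    have hsu := (hu s).1 hs
    have hsv := (hv s).1 hs
    have hsx : s ≠ x := by rintro rfl; omega
    have hsy : s ≠ y := by rintro rfl; omega
    obtain ⟨a, b, rfl, ha, hb⟩ := exists_split_of_count_eq_one hsu
    obtain ⟨c, d, rfl, hc, hd⟩ := exists_split_of_count_eq_one hsv
    have hsub : ∀ z, ({z, s} : Finset ℕ) ⊆ insert z T := fun z => by
      simp [Finset.insert_subset_iff, hs]
    simp only [List.count_append, List.count_cons_of_ne hsx, List.count_cons_of_ne hsy] at *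
    exact ⟨a, b, c, d, rfl, rfl, ha, hb, hc, hd, hsx, hsy, hxu, hyu,
      count_eq_of_proj_eq ha hc (proj_eq_of_subset (hsub x) px),
      count_eq_of_proj_eq ha hc (proj_eq_of_subset (hsub y) py), hxv, hyv⟩
  by_cases hB : SameBlocks T x y u
  · refine Or.inr ⟨?_, hB⟩
    obtain ⟨s, hs, e, f, rfl, hxe, hxf⟩ := exists_separator hxu hx
    have hB := hB s hs
    obtain ⟨a, b, c, d, eu, rfl, ha, hb, hc, hd, hsx, hsy, k1, k2, k3, k4, k5, k6⟩ := split s hs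
    rw [eu, map_proj_split hsx.symm ha hb, map_proj_split hsy.symm ha hb] at hB
    have hse : s ∉ e := by
      have := (hu s).1 hs
      rw [List.count_append, List.count_cons_self] at this
      exact List.count_eq_zero.1 (by omega)
    have := append_cons_left_inj eu hse ha
    subst this
    have hay : e.count x = e.count y := by
      have := append_cons_left_inj hB (by simp) (by simp)
      simpa using congrArg List.length this
    rw [eu] at h fu
    rw [firstOf_comm] at fv
    obtain ⟨q, hq, e1⟩ := proj_three hxy ha hb (by omega) (by omega) (by omega) (by omega) fu
    obtain ⟨q', hq', e2⟩ := proj_three hxy.symm hc hd (by omega) (by omega) (by omega) (by omega) fv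
    have := hR.project {x, y, s} h
    rw [e1, Finset.insert_comm, e2] at this
    exact hR.swapsParallel_of_letters hxy hsx hsy hq hq'.symm this
  · left
    simp only [SameBlocks, not_forall] at hB
    obtain ⟨s, hs, hB⟩ := hB
    obtain ⟨a, b, c, d, eu, ev, ha, hb, hc, hd, hsx, hsy, k1, k2, k3, k4, k5, k6⟩ := split s hs
    rw [eu, map_proj_split hsx.symm ha hb, map_proj_split hsy.symm ha hb] at hB
    have hne : a.count x ≠ a.count y := by
      intro e
      rw [e, show b.count x = b.count y by omega] at hB
      exact hB rfl
    have g1 : 1 ≤ a.count y → 1 ≤ a.count x := fun h =>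
      List.count_pos_iff.2 (mem_of_firstOf (eu ▸ fu) (List.count_pos_iff.1 h))
    have g2 : 1 ≤ c.count x → 1 ≤ c.count y := fun h =>
      List.count_pos_iff.2 (mem_of_firstOf (by rw [firstOf_comm, ← ev]; exact fv)
        (List.count_pos_iff.1 h))
    rcases Nat.lt_or_gt_of_ne hne with hlt | hlt
    · exact hR.swapsFirst_of_blocks hxy hu hv hxu hyu hxv hyv hy px py fu fv hs eu ev (by omega)
        (by omega) (by omega) (by omega) h
    · have hx' : ¬ HasSquare T x v := by rwa [HasSquare, ← px]
      exact hR.swapsFirst_of_blocks hxy.symm hv hu hyv hxv hyu hxu hx' py.symm px.symm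
        (by rw [firstOf_comm]; exact fv) (by rw [firstOf_comm]; exact fu) hs ev eu (by omega)
        (by omega) (by omega) (by omega) (hR.symm h)

end Admissible

/-- Related words have the same letters and the same subword of simple letters, and `xtx` is not
related to `x²t`. -/
structure Faithful (R : List ℕ → List ℕ → Prop) : Prop where
  mem : ∀ {u v}, R u v → ∀ z, z ∈ u ↔ z ∈ v
  simple_iff : ∀ {u v}, R u v → ∀ z, u.count z = 1 ↔ v.count z = 1
  simple : ∀ {u v} {T : Finset ℕ}, R u v → (∀ z, z ∈ T ↔ u.count z = 1) → proj T u = proj T v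
  not_gathers : ¬ Gathers R 1

lemma firstOf_eq_or {x y : ℕ} {u : List ℕ} (h : x ∈ u) :
    firstOf x y u = some x ∨ firstOf x y u = some y := by
  have h1 : x ∈ proj {x, y} u := mem_proj.2 ⟨h, by simp⟩
  rw [firstOf]
  rcases hp : proj {x, y} u with _ | ⟨a, l⟩
  · simp [hp] at h1
  · have : a ∈ proj {x, y} u := by simp [hp]
    simpa using (mem_proj.1 this).2

lemma HasSquare.of_proj_eq {T : Finset ℕ} {x : ℕ} {u v : List ℕ} (h : HasSquare T x u)
    (e : proj (insert x T) u = proj (insert x T) v) : HasSquare T x v := by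
  rwa [HasSquare, ← e]

lemma count_eq_of_proj_insert {T : Finset ℕ} {x : ℕ} {u v : List ℕ}
    (e : proj (insert x T) u = proj (insert x T) v) : u.count x = v.count x := by
  rw [← count_proj (Finset.mem_insert_self x T) u, e, count_proj (Finset.mem_insert_self x T)]

lemma Collapses.of_proj_eq {R : List ℕ → List ℕ → Prop} {T : Finset ℕ} {x : ℕ} {u v : List ℕ}
    (h : Collapses R T x u) (e : proj (insert x T) u = proj (insert x T) v) :
    Collapses R T x v := by
  rw [Collapses, ← count_eq_of_proj_insert e]
  exact h.imp_left fun h => h.of_proj_eq e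

lemma SameBlocks.of_proj_eq {T : Finset ℕ} {x y : ℕ} {u v : List ℕ} (h : SameBlocks T x y u)
    (ex : proj (insert x T) u = proj (insert x T) v)
    (ey : proj (insert y T) u = proj (insert y T) v) : SameBlocks T x y v := by
  intro s hs
  have hsub : ∀ z, ({z, s} : Finset ℕ) ⊆ insert z T := fun z => by
    simp [Finset.insert_subset_iff, hs]
  rw [← proj_eq_of_subset (hsub x) ex, ← proj_eq_of_subset (hsub y) ey]
  exact h s hs

namespace Admissible

variable {R : List ℕ → List ℕ → Prop} (hR : Admissible R) (hF : Faithful R)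
include hR hF

lemma proj_eq_of_not_hasSquare {T : Finset ℕ} {x : ℕ} {u v : List ℕ}
    (hu : ∀ z, z ∈ T ↔ u.count z = 1) (h : R u v) (hxu : u.count x = 2)
    (hx : ¬ HasSquare T x u) : proj (insert x T) u = proj (insert x T) v := by
  have hxv : 2 ≤ v.count x := by
    have h1 := List.count_pos_iff.2 ((hF.mem h x).1 (List.count_pos_iff.1 (by omega)))
    have h2 := (hF.simple_iff h x).2
    omega
  refine (hR.position_of_rel hu (hF.simple h hu) hxu.ge hxv h).resolve_right ?_
  rintro ⟨h | ⟨k, h1, h2, h3⟩, -⟩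
  · exact hx h
  · obtain rfl : k = 1 := by omega
    exact hF.not_gathers h3

lemma order_of_rel {T : Finset ℕ} {x y : ℕ} {u v : List ℕ} (hxy : x ≠ y)
    (hu : ∀ z, z ∈ T ↔ u.count z = 1) (h : R u v) (hxu : u.count x = 2) (hyu : u.count y = 2)
    (hx : ¬ HasSquare T x u) (hy : ¬ HasSquare T y u) :
    firstOf x y u = firstOf x y v ∨ SwapsFirst R ∨ SwapsParallel R ∧ SameBlocks T x y u := by
  have px := hR.proj_eq_of_not_hasSquare hF hu h hxu hx
  have py := hR.proj_eq_of_not_hasSquare hF hu h hyu hy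
  have hxv := (count_eq_of_proj_insert px).symm.trans hxu
  have hyv := (count_eq_of_proj_insert py).symm.trans hyu
  have hv : ∀ z, z ∈ T ↔ v.count z = 1 := fun z => (hu z).trans (hF.simple_iff h z)
  have hxm : x ∈ u := List.count_pos_iff.1 (by omega)
  rcases firstOf_eq_or (y := y) hxm with fu | fu <;>
    rcases firstOf_eq_or (y := y) ((hF.mem h x).1 hxm) with fv | fv
  · exact Or.inl (fu.trans fv.symm)
  · exact Or.inr (hR.order_of_rel_aux hxy hu hv hxu hyu hxv hyv hx hy px py fu fv h)
  · rw [firstOf_comm] at fu fv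
    exact Or.inr ((hR.order_of_rel_aux hxy.symm hu hv hyu hxu hyv hxv hy hx py px fu fv h).imp_right
      fun h => ⟨h.1, h.2.symm⟩)
  · exact Or.inl (fu.trans fv.symm)

lemma compatible_of_rel {T : Finset ℕ} {u v : List ℕ} (hu : ∀ z, z ∈ T ↔ u.count z = 1)
    (h : R u v) : Compatible R T u v where
  left := hu
  right z := (hu z).trans (hF.simple_iff h z)
  mem := hF.mem h
  simple := hF.simple h hu
  position x hxu hxv := hR.position_of_rel hu (hF.simple h hu) hxu hxv h
  order x y hxy hxu hxv hyu hyv := by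
    have hv : ∀ z, z ∈ T ↔ v.count z = 1 := fun z => (hu z).trans (hF.simple_iff h z)
    have both : ∀ x, u.count x = 2 → v.count x = 2 → (HasSquare T x u ↔ HasSquare T x v) := by
      intro x h1 h2
      constructor <;> intro h3 <;> by_contra h4
      · exact h4 (h3.of_proj_eq (hR.proj_eq_of_not_hasSquare hF hv (hR.symm h) h2 h4).symm)
      · exact h4 (h3.of_proj_eq (hR.proj_eq_of_not_hasSquare hF hu h h1 h4).symm)
    by_cases hx : HasSquare T x u
    · exact Or.inl ⟨hx, (both x hxu hxv).1 hx⟩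
    by_cases hy : HasSquare T y u
    · exact Or.inr (Or.inl ⟨hy, (both y hyu hyv).1 hy⟩)
    exact Or.inr (Or.inr (hR.order_of_rel hF hxy hu h hxu hyu hx hy))

end Admissible

/-- The simple letters of a word. -/
def simples (u : List ℕ) : Finset ℕ := u.toFinset.filter fun z => u.count z = 1

lemma mem_simples {u : List ℕ} (z : ℕ) : z ∈ simples u ↔ u.count z = 1 := by
  simp only [simples, Finset.mem_filter, List.mem_toFinset, and_iff_right_iff_imp]
  intro h
  exact List.count_pos_iff.1 (by omega)

/-- Words with a common subword on `T` can be amalgamated. -/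
lemma exists_amalgam {A T : Finset ℕ} (hAT : Disjoint A T) : ∀ (p q : List ℕ),
    (∀ a ∈ p, a ∈ A ∪ T) → (∀ a ∈ q, a ∉ A) → proj T p = proj T q →
    ∃ r, proj (A ∪ T) r = p ∧ r.filter (· ∉ A) = q
  | [], q, _, hq, h => by
    refine ⟨q, proj_eq_nil fun a ha haS => ?_, List.filter_eq_self.2 (by simpa using hq)⟩
    rcases Finset.mem_union.1 haS with h1 | h1
    · exact hq a ha h1
    · have : a ∈ proj T q := mem_proj.2 ⟨ha, h1⟩
      rw [← h] at this
      simp [proj] at this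
  | a :: p, q, hp, hq, h => by
    rcases Finset.mem_union.1 (hp a (by simp)) with ha | ha
    · rw [proj_cons_notMem (Finset.disjoint_left.1 hAT ha)] at h
      obtain ⟨r, h1, h2⟩ := exists_amalgam hAT p q (fun b hb => hp b (by simp [hb])) hq h
      exact ⟨a :: r, by rw [proj_cons_mem (by simp [ha]), h1], by simp [ha, ← h2]⟩
    · rw [proj_cons_mem ha, eq_comm, proj, List.filter_eq_cons_iff] at h
      obtain ⟨q₁, q₂, rfl, hq₁, -, h⟩ := h
      obtain ⟨r, h1, h2⟩ := exists_amalgam hAT p q₂ (fun b hb => hp b (by simp [hb]))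
        (fun b hb => hq b (by simp [hb])) h.symm
      have haA := Finset.disjoint_right.1 hAT ha
      refine ⟨q₁ ++ a :: r, ?_, ?_⟩
      · rw [proj_append, proj_cons_mem (by simp [ha]), h1, proj_eq_nil, List.nil_append]
        intro b hb hbS
        have h3 := hq₁ b hb
        have h4 := hq b (by simp [hb])
        simp at h3 hbS
        tauto
      · rw [List.filter_append, List.filter_cons_of_pos (by simpa using haA), h2,
          List.filter_eq_self.2]
        intro b hb
        simpa using hq b (by simp [hb])

lemma exists_exchange {α β R₁ R₂ : List ℕ → List ℕ → Prop} (hα : Admissible α)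
    (hβ : Admissible β) (h₁ : Admissible R₁) (h₂ : Admissible R₂) (F₁ : Faithful R₁)
    (F₂ : Faithful R₂)
    (G₁ : ∀ k, Gathers R₁ k → Gathers α k) (G₂ : ∀ k, Gathers R₂ k → Gathers α k)
    (S₁ : SwapsFirst R₁ → SwapsFirst β) (S₂ : SwapsFirst R₂ → SwapsFirst β)
    (P₁ : SwapsParallel R₁ → SwapsParallel β) (P₂ : SwapsParallel R₂ → SwapsParallel β)
    {u m w : List ℕ} (hum : R₁ u m) (hmw : R₂ m w) : ∃ v, β u v ∧ α v w := by
  set T := simples u with hT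
  have hu : ∀ z, z ∈ T ↔ u.count z = 1 := mem_simples
  have hm : ∀ z, z ∈ T ↔ m.count z = 1 := fun z => (hu z).trans (F₁.simple_iff hum z)
  have hw : ∀ z, z ∈ T ↔ w.count z = 1 := fun z => (hm z).trans (F₂.simple_iff hmw z)
  have hsim : proj T u = proj T w := (F₁.simple hum hu).trans (F₂.simple hmw hm)
  set A : Finset ℕ := by
    classical
    exact u.toFinset.filter fun x => u.count x = 2 ∧ ¬ HasSquare T x u with hA
  have memA : ∀ x, x ∈ A ↔ u.count x = 2 ∧ ¬ HasSquare T x u := by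
    intro x
    simp only [hA, Finset.mem_filter, List.mem_toFinset, and_iff_right_iff_imp]
    intro h
    exact List.count_pos_iff.1 (by omega)
  have projA₁ : ∀ x ∈ A, proj (insert x T) u = proj (insert x T) m := fun x hx =>
    h₁.proj_eq_of_not_hasSquare F₁ hu hum ((memA x).1 hx).1 ((memA x).1 hx).2
  have memA' : ∀ x ∈ A, m.count x = 2 ∧ ¬ HasSquare T x m := fun x hx =>
    ⟨(count_eq_of_proj_insert (projA₁ x hx)).symm.trans ((memA x).1 hx).1,
      fun h => ((memA x).1 hx).2 (h.of_proj_eq (projA₁ x hx).symm)⟩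
  have projA₂ : ∀ x ∈ A, proj (insert x T) m = proj (insert x T) w := fun x hx =>
    h₂.proj_eq_of_not_hasSquare F₂ hm hmw (memA' x hx).1 (memA' x hx).2
  have hAT : Disjoint A T := Finset.disjoint_left.2 fun x hx hxT => by
    have h1 := (memA x).1 hx
    have h2 := (hu x).1 hxT
    omega
  obtain ⟨v, hv₁, hv₂⟩ := exists_amalgam hAT (proj (A ∪ T) w) (u.filter (· ∉ A))
    (fun a ha => (mem_proj.1 ha).2) (by simp) (by
      rw [proj_proj Finset.subset_union_right, ← hsim]
      simp only [proj, List.filter_filter]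
      refine List.filter_congr fun a _ => ?_
      by_cases ha : a ∈ T
      · simp [ha, Finset.disjoint_right.1 hAT ha]
      · simp [ha])
  have onA : ∀ S : Finset ℕ, S ⊆ A ∪ T → proj S v = proj S w := fun S hS =>
    proj_eq_of_subset hS hv₁
  have offA : ∀ S : Finset ℕ, (∀ z ∈ S, z ∉ A) → proj S v = proj S u := by
    intro S hS
    have e : ∀ l : List ℕ, proj S (l.filter (· ∉ A)) = proj S l := by
      intro l
      rw [proj, List.filter_filter]
      refine List.filter_congr fun a _ => ?_
      by_cases ha : a ∈ S
      · simp [ha, hS a ha]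
      · simp [ha]
    rw [← e v, hv₂, e]
  have insA : ∀ x, x ∉ A → ∀ z ∈ insert x T, z ∉ A := by
    intro x hx z hz
    rcases Finset.mem_insert.1 hz with rfl | hz
    exacts [hx, Finset.disjoint_right.1 hAT hz]
  have pos : ∀ x, proj (insert x T) u = proj (insert x T) v := by
    intro x
    by_cases hx : x ∈ A
    · rw [onA (insert x T) (Finset.insert_subset (by simp [hx]) Finset.subset_union_right),
        projA₁ x hx, projA₂ x hx]
    · rw [offA (insert x T) (insA x hx)]
  have cnt : ∀ x, u.count x = v.count x := fun x => count_eq_of_proj_insert (pos x)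
  have hv : ∀ z, z ∈ T ↔ v.count z = 1 := fun z => by rw [hu, cnt]
  have mem : ∀ z, z ∈ u ↔ z ∈ v := fun z => by
    rw [← List.count_pos_iff, cnt, List.count_pos_iff]
  have first : ∀ x ∈ A, ∀ y ∈ A, firstOf x y v = firstOf x y w := by
    intro x hx y hy
    rw [firstOf, onA {x, y} (by simp [Finset.insert_subset_iff, hx, hy]), firstOf]
  have sqv : ∀ x, u.count x = 2 → x ∉ A → HasSquare T x u := by
    intro x h1 h2
    rw [memA] at h2
    tauto
  refine ⟨v, hβ.of_compatible (T := T) ⟨hu, hv, mem, ?_, fun x _ _ => Or.inl (pos x), ?_⟩,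
    hα.of_compatible (T := T) ⟨hv, hw, ?_, ?_, ?_, ?_⟩⟩
  · rw [offA T fun z hz => Finset.disjoint_right.1 hAT hz]
  · intro x y hxy hxu _ hyu _
    by_cases hx : x ∈ A
    · by_cases hy : y ∈ A
      · refine Or.inr (Or.inr ?_)
        rw [first x hx y hy]
        have o₁ := h₁.order_of_rel F₁ hxy hu hum hxu hyu ((memA x).1 hx).2 ((memA y).1 hy).2
        have o₂ := h₂.order_of_rel F₂ hxy hm hmw (memA' x hx).1 (memA' y hy).1 (memA' x hx).2
          (memA' y hy).2
        rcases o₁ with o₁ | o₁ | ⟨o₁, b⟩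
        · rcases o₂ with o₂ | o₂ | ⟨o₂, b⟩
          · exact Or.inl (o₁.trans o₂)
          · exact Or.inr (Or.inl (S₂ o₂))
          · exact Or.inr (Or.inr ⟨P₂ o₂, b.of_proj_eq (projA₁ x hx).symm (projA₁ y hy).symm⟩)
        · exact Or.inr (Or.inl (S₁ o₁))
        · exact Or.inr (Or.inr ⟨P₁ o₁, b⟩)
      · exact Or.inr (Or.inl ⟨sqv y hyu hy, (sqv y hyu hy).of_proj_eq (pos y)⟩)
    · exact Or.inl ⟨sqv x hxu hx, (sqv x hxu hx).of_proj_eq (pos x)⟩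
  · exact fun z => (mem z).symm.trans ((F₁.mem hum z).trans (F₂.mem hmw z))
  · exact onA T Finset.subset_union_right
  · intro x hxv hxw
    rw [← cnt] at hxv
    have hxm : 2 ≤ m.count x := by
      have h1 := List.count_pos_iff.2 ((F₁.mem hum x).1 (List.count_pos_iff.1 (by omega)))
      have h2 := (F₁.simple_iff hum x).2
      omega
    rcases h₁.position_of_rel hu (F₁.simple hum hu) hxv hxm hum with e₁ | ⟨c₁, c₂⟩ <;>
      rcases h₂.position_of_rel hm (F₂.simple hmw hm) hxm hxw hmw with e₂ | ⟨c₃, c₄⟩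
    · exact Or.inl ((pos x).symm.trans (e₁.trans e₂))
    · exact Or.inr ⟨(c₃.mono G₂).of_proj_eq (e₁.symm.trans (pos x)), c₄.mono G₂⟩
    · exact Or.inr ⟨(c₁.mono G₁).of_proj_eq (pos x), (c₂.mono G₁).of_proj_eq e₂⟩
    · exact Or.inr ⟨(c₁.mono G₁).of_proj_eq (pos x), c₄.mono G₂⟩
  · have sqw : ∀ x, v.count x = 2 → w.count x = 2 → x ∉ A → HasSquare T x v ∧ HasSquare T x w := by
      intro x h1 h2 hx
      rw [← cnt] at h1
      have hsu := sqv x h1 hx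
      refine ⟨hsu.of_proj_eq (pos x), ?_⟩
      by_contra hsw
      have e₂ := h₂.proj_eq_of_not_hasSquare F₂ hw (h₂.symm hmw) h2 hsw
      have e₁ := h₁.proj_eq_of_not_hasSquare F₁ hm (h₁.symm hum)
        ((count_eq_of_proj_insert e₂).symm.trans h2) (fun h => hsw (h.of_proj_eq e₂.symm))
      exact hsw (hsu.of_proj_eq (e₂.trans e₁).symm)
    intro x y hxy hxv hxw hyv hyw
    by_cases hx : x ∈ A
    · by_cases hy : y ∈ A
      · exact Or.inr (Or.inr (Or.inl (first x hx y hy)))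
      · exact Or.inr (Or.inl (sqw y hyv hyw hy))
    · exact Or.inl (sqw x hxv hxw hx)

/-- Pairs in `α ∘ β` lie in `β ∘ α`. -/
def Exchanges (α β : List ℕ → List ℕ → Prop) : Prop :=
  ∀ {u m w}, α u m → β m w → ∃ v, β u v ∧ α v w

lemma Exchanges.of_le {α β : List ℕ → List ℕ → Prop} (hβ : Admissible β)
    (hα : Admissible α) (h : ∀ u v, β u v → α u v) : Exchanges α β ∧ Exchanges β α :=
  ⟨fun h1 h2 => ⟨_, hβ.refl _, hα.trans h1 (h _ _ h2)⟩,
    fun h1 h2 => ⟨_, hα.trans (h _ _ h1) h2, hβ.refl _⟩⟩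

lemma gathers_total {α β : List ℕ → List ℕ → Prop} (hα : Admissible α) (hβ : Admissible β) :
    (∀ k, Gathers β k → Gathers α k) ∨ ∀ k, Gathers α k → Gathers β k := by
  by_contra! ⟨⟨k, hk, hk'⟩, l, hl, hl'⟩
  rcases le_total k l with h | h
  · exact hl' (hβ.gathers_mono h hk)
  · exact hk' (hα.gathers_mono h hl)

lemma swaps_total (α β : List ℕ → List ℕ → Prop) :
    ((SwapsFirst β → SwapsFirst α) ∧ (SwapsParallel β → SwapsParallel α)) ∨
      (SwapsFirst α → SwapsFirst β) ∧ (SwapsParallel α → SwapsParallel β) := by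
  have h1 := @SwapsFirst.swapsParallel α
  have h2 := @SwapsFirst.swapsParallel β
  tauto

lemma le_of_levels {α β : List ℕ → List ℕ → Prop} (hα : Admissible α) (hβ : Admissible β)
    (Fβ : Faithful β) (hG : ∀ k, Gathers β k → Gathers α k) (hS : SwapsFirst β → SwapsFirst α)
    (hP : SwapsParallel β → SwapsParallel α) (u v : List ℕ) (h : β u v) : α u v :=
  hα.of_compatible ((hβ.compatible_of_rel Fβ mem_simples h).mono hG hS hP)

lemma Faithful.exchanges {α β : List ℕ → List ℕ → Prop} (Fα : Faithful α) (Fβ : Faithful β)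
    (hα : Admissible α) (hβ : Admissible β) : Exchanges α β := by
  rcases gathers_total hα hβ with hG | hG <;> rcases swaps_total α β with ⟨hS, hP⟩ | ⟨hS, hP⟩
  · exact (Exchanges.of_le hβ hα (le_of_levels hα hβ Fβ hG hS hP)).1
  · exact fun h1 h2 => exists_exchange hα hβ hα hβ Fα Fβ (fun _ => id) hG hS id hP id h1 h2
  · intro u m w h1 h2
    obtain ⟨v, h3, h4⟩ := exists_exchange hβ hα hβ hα Fβ Fα (fun _ => id) hG hS id hP id
      (hβ.symm h2) (hα.symm h1)
    exact ⟨v, hβ.symm h4, hα.symm h3⟩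
  · exact (Exchanges.of_le hα hβ (le_of_levels hβ hα Fα hG hS hP)).2

/-- The substitution sending `x` to `p`, `y` to `q` and other letters to the empty word. -/
def pairSubst (x y : ℕ) (p q : List ℕ) (a : ℕ) : List ℕ :=
  if a = x then p else if a = y then q else []

lemma flatMap_pairSubst_proj (x y : ℕ) (p q u : List ℕ) :
    (proj {x, y} u).flatMap (pairSubst x y p q) = u.flatMap (pairSubst x y p q) := by
  induction u with
  | nil => rfl
  | cons a u ih =>
    by_cases ha : a ∈ ({x, y} : Finset ℕ)
    · rw [proj_cons_mem ha, List.flatMap_cons, List.flatMap_cons, ih]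
    · rw [proj_cons_notMem ha, List.flatMap_cons, ih]
      simp only [Finset.mem_insert, Finset.mem_singleton, not_or] at ha
      simp [pairSubst, ha]

lemma flatMap_pairSubst_self (z : ℕ) (p u : List ℕ) :
    u.flatMap (pairSubst z z p p) = (List.replicate (u.count z) p).flatten := by
  induction u with
  | nil => rfl
  | cons a u ih =>
    rw [List.flatMap_cons, ih]
    by_cases ha : a = z
    · subst ha
      simp [pairSubst, List.replicate_succ]
    · simp [pairSubst, ha]

lemma eq_of_proj_pair_eq : ∀ (p q : List ℕ), p.Nodup → q.Nodup → (∀ z, z ∈ p ↔ z ∈ q) →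
    (∀ x ∈ p, ∀ y ∈ p, proj {x, y} p = proj {x, y} q) → p = q
  | [], [], _, _, _, _ => rfl
  | [], b :: q, _, _, h, _ => by simpa using h b
  | a :: p, [], _, _, h, _ => by simpa using h a
  | a :: p, b :: q, hp, hq, h, hxy => by
    have hb := (h b).2 (by simp)
    have hab : a = b := by
      have := hxy a (by simp) b hb
      rw [proj_cons_mem (by simp), proj_cons_mem (by simp)] at this
      exact (List.cons.inj this).1
    subst hab
    rw [List.nodup_cons] at hp hq
    congr 1
    refine eq_of_proj_pair_eq p q hp.2 hq.2 (fun z => ?_) fun x hx y hy => ?_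
    · have := h z
      simp only [List.mem_cons] at this
      rcases eq_or_ne z a with rfl | hz
      · simp [hp.1, hq.1]
      · simpa [hz] using this
    · have := hxy x (by simp [hx]) y (by simp [hy])
      have ha : a ∉ ({x, y} : Finset ℕ) := by
        simp only [Finset.mem_insert, Finset.mem_singleton, not_or]
        constructor <;> rintro rfl <;> exact hp.1 (by assumption)
      rwa [proj_cons_notMem ha, proj_cons_notMem ha] at this

namespace Admissible

variable {R : List ℕ → List ℕ → Prop} (hR : Admissible R)
include hR

lemma flatten_replicate (p : List ℕ) (n : ℕ) :
    R (p ++ p) ((List.replicate (n + 2) p).flatten) := by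
  induction n with
  | zero => simpa [List.replicate_succ] using hR.refl _
  | succ n ih =>
    have := hR.trans (hR.cube p) (by simpa using hR.ctx p [] ih)
    simpa [List.replicate_succ] using this

lemma total_of_not_mem (h : ¬ ∀ {u v}, R u v → ∀ z, z ∈ u ↔ z ∈ v) (u v : List ℕ) : R u v := by
  obtain ⟨u', v', hz, z, h1, h2⟩ : ∃ u v, R u v ∧ ∃ z, z ∈ u ∧ z ∉ v := by
    by_contra! hc
    exact h fun {u v} huv z => ⟨hc u v huv z, hc v u (hR.symm huv) z⟩
  have nil : ∀ p, R p [] := by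
    intro p
    have h3 := hR.subst (pairSubst z z p p) hz
    rw [flatMap_pairSubst_self, flatMap_pairSubst_self, List.count_eq_zero.2 h2] at h3
    obtain ⟨n, hn⟩ := Nat.exists_eq_add_one.2 (List.count_pos_iff.2 h1)
    rw [hn] at h3
    simp only [List.replicate_zero, List.flatten_nil] at h3
    rcases n with _ | n
    · simpa [List.replicate_succ] using h3
    · have h4 := hR.symm (hR.ctx p [] h3)
      have h5 := hR.trans (hR.symm (hR.flatten_replicate p (n + 1))) (hR.flatten_replicate p n)
      exact hR.trans (by simpa [List.replicate_succ] using h4)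
        (hR.trans (by simpa [List.replicate_succ] using h5) h3)
  exact hR.trans (nil u) (hR.symm (nil v))

lemma of_gathers_one (hG : Gathers R 1) {T : Finset ℕ} {u v : List ℕ}
    (hu : ∀ z, z ∈ T ↔ u.count z = 1) (hv : ∀ z, z ∈ T ↔ v.count z = 1)
    (hm : ∀ z, z ∈ u ↔ z ∈ v) (hs : proj T u = proj T v) : R u v :=
  hR.of_central _ u v rfl hu hv hm hs
    (fun _ h1 h2 => Or.inr ⟨hR.central_of_gathers hG h1, hR.central_of_gathers hG h2⟩)
    fun _ _ _ h1 h2 _ _ =>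
      Or.inl ⟨hR.central_of_gathers hG h1.ge, hR.central_of_gathers hG h2.ge⟩

lemma idempotent_of_not_simple_iff (hm : ∀ {u v}, R u v → ∀ z, z ∈ u ↔ z ∈ v)
    (h : ¬ ∀ {u v}, R u v → ∀ z, u.count z = 1 ↔ v.count z = 1) (p : List ℕ) : R p (p ++ p) := by
  obtain ⟨u, v, huv, z, h1, h2⟩ : ∃ u v, R u v ∧ ∃ z, u.count z = 1 ∧ v.count z ≠ 1 := by
    by_contra! hc
    exact h fun {u v} huv z => ⟨hc u v huv z, hc v u (hR.symm huv) z⟩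
  have h3 := List.count_pos_iff.2 ((hm huv z).1 (List.count_pos_iff.1 (by omega)))
  obtain ⟨n, hn⟩ : ∃ n, v.count z = n + 2 := ⟨v.count z - 2, by omega⟩
  have h4 := hR.subst (pairSubst z z p p) huv
  rw [flatMap_pairSubst_self, flatMap_pairSubst_self, h1, hn] at h4
  exact hR.trans (by simpa using h4) (hR.symm (hR.flatten_replicate p n))

lemma of_idempotent (h : ∀ p, R p (p ++ p)) {u v : List ℕ} (hm : ∀ z, z ∈ u ↔ z ∈ v) :
    R u v := by
  have hc : ∀ x y, R (x ++ y) (y ++ x) := fun x y =>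
    hR.trans (by simpa using hR.ctx [] y (h x))
      (hR.trans (hR.comm x y) (by simpa using hR.ctx y [] (hR.symm (h x))))
  have hG : Gathers R 1 := by
    intro x ps hl
    obtain ⟨p, rfl⟩ := List.length_eq_one_iff.1 hl
    simpa [interleave] using hR.ctx x [] (hc p x)
  have hT : ∀ u : List ℕ, ∀ z, z ∈ (∅ : Finset ℕ) ↔ (u ++ u).count z = 1 := fun u z => by
    rw [List.count_append]
    simp only [Finset.notMem_empty, false_iff]
    omega
  have := hR.of_gathers_one hG (hT u) (hT v) (by simpa using hm) (by simp [proj])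
  exact hR.trans (h u) (hR.trans this (hR.symm (h v)))

lemma commutative_of_not_simple (hm : ∀ {u v}, R u v → ∀ z, z ∈ u ↔ z ∈ v)
    (hi : ∀ {u v}, R u v → ∀ z, u.count z = 1 ↔ v.count z = 1)
    (h : ¬ ∀ {u v} {T : Finset ℕ}, R u v → (∀ z, z ∈ T ↔ u.count z = 1) → proj T u = proj T v)
    (p q : List ℕ) : R (p ++ q) (q ++ p) := by
  push Not at h
  obtain ⟨u, v, T, huv, hT, hne⟩ := h
  have hT' : ∀ z, z ∈ T ↔ v.count z = 1 := fun z => (hT z).trans (hi huv z)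
  have nodup : ∀ w : List ℕ, (∀ z, z ∈ T ↔ w.count z = 1) → (proj T w).Nodup := by
    intro w hw
    refine List.nodup_iff_count_le_one.2 fun a => ?_
    by_cases ha : a ∈ T
    · rw [count_proj ha, (hw a).1 ha]
    · rw [List.count_eq_zero.2 fun h => ha (mem_proj.1 h).2]
      exact zero_le_one
  obtain ⟨x, hx, y, hy, hxy⟩ :
      ∃ x ∈ T, ∃ y ∈ T, proj {x, y} u ≠ proj {x, y} v := by
    by_contra! hc
    refine hne (eq_of_proj_pair_eq _ _ (nodup u hT) (nodup v hT') (fun z => ?_)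
      fun x hx y hy => ?_)
    · rw [mem_proj, mem_proj, hm huv]
    · have hx := (mem_proj.1 hx).2
      have hy := (mem_proj.1 hy).2
      rw [proj_proj (by simp [Finset.insert_subset_iff, hx, hy]),
        proj_proj (by simp [Finset.insert_subset_iff, hx, hy]), hc x hx y hy]
  have form : ∀ w : List ℕ, (∀ z, z ∈ T ↔ w.count z = 1) →
      x ≠ y ∧ proj {x, y} w = [x, y] ∨ x ≠ y ∧ proj {x, y} w = [y, x] ∨
        x = y ∧ proj {x, y} w = [x] := by
    intro w hw
    have h1 := (hw x).1 hx
    have h2 := (hw y).1 hy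
    have hp : ∀ l : List ℕ, l.Nodup → (∀ z, z ∈ proj {x, y} w ↔ z ∈ l) →
        (proj {x, y} w).Perm l := fun l hl hz => by
      refine (List.perm_ext_iff_of_nodup ?_ hl).2 hz
      rw [← proj_proj (S' := T) (by simp [Finset.insert_subset_iff, hx, hy])]
      exact (nodup w hw).filter _
    have hxw : x ∈ w := List.count_pos_iff.1 (by omega)
    have hyw : y ∈ w := List.count_pos_iff.1 (by omega)
    have hz : ∀ z, z ∈ proj {x, y} w ↔ z = x ∨ z = y := fun z => by
      rw [mem_proj]
      simp only [Finset.mem_insert, Finset.mem_singleton, and_iff_right_iff_imp]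
      rintro (rfl | rfl) <;> assumption
    by_cases e : x = y
    · subst e
      exact Or.inr (Or.inr ⟨rfl, List.perm_singleton.1 (hp [x] (by simp) (by simpa using hz))⟩)
    · have := hp [x, y] (by simpa using e) (by simpa using hz)
      obtain ⟨a, b, hab⟩ := List.length_eq_two.1 this.length_eq
      have hnd := this.nodup_iff.2 (by simpa using e)
      have ha := (hz a).1 (by simp [hab])
      have hb := (hz b).1 (by simp [hab])
      rw [hab] at hnd ⊢
      have : a ≠ b := by simpa using hnd
      rcases ha with rfl | rfl <;> rcases hb with rfl | rfl <;> simp_all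
  have hsub := hR.subst (pairSubst x y p q) huv
  rw [← flatMap_pairSubst_proj x y p q u, ← flatMap_pairSubst_proj x y p q v] at hsub
  rcases form u hT with ⟨e, h1⟩ | ⟨e, h1⟩ | ⟨e, h1⟩ <;>
    rcases form v hT' with ⟨e', h2⟩ | ⟨e', h2⟩ | ⟨e', h2⟩
  all_goals first
    | exact absurd (h1.trans h2.symm) hxy
    | exact absurd e e'
    | exact absurd e' e
    | skip
  · rw [h1, h2] at hsub
    simpa [pairSubst, e.symm] using hsub
  · rw [h1, h2] at hsub
    exact hR.symm (by simpa [pairSubst, e.symm] using hsub)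

lemma of_commutative (h : ∀ p q, R (p ++ q) (q ++ p)) {u v : List ℕ}
    (hm : ∀ z, z ∈ u ↔ z ∈ v) (hi : ∀ z, u.count z = 1 ↔ v.count z = 1) : R u v := by
  have hG : Gathers R 1 := by
    intro x ps hl
    obtain ⟨p, rfl⟩ := List.length_eq_one_iff.1 hl
    simpa [interleave] using hR.ctx x [] (h p x)
  have hperm : ∀ {u v : List ℕ}, u.Perm v → R u v := by
    intro u v huv
    induction huv with
    | nil => exact hR.refl _
    | cons a _ ih => simpa using hR.ctx [a] [] ih
    | swap a b l => simpa using hR.ctx [] l (h [b] [a])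
    | trans _ _ h1 h2 => exact hR.trans h1 h2
  set T := simples u
  have hT : ∀ z, z ∈ T ↔ u.count z = 1 := mem_simples
  have hT' : ∀ z, z ∈ T ↔ v.count z = 1 := fun z => (hT z).trans (hi z)
  set v' := proj T u ++ v.filter (· ∉ T)
  have hv' : v'.Perm v := by
    rw [List.perm_iff_count]
    intro z
    rw [List.count_append]
    by_cases hz : z ∈ T
    · rw [count_proj hz, (hT z).1 hz, (hT' z).1 hz, List.count_eq_zero.2 (by simp [hz])]
    · rw [List.count_eq_zero.2 fun h => hz (mem_proj.1 h).2, List.count_filter (by simpa using hz),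
        zero_add]
  refine hR.trans (hR.of_gathers_one hG hT (fun z => ?_) (fun z => ?_) ?_) (hperm hv')
  · rw [hT', hv'.count_eq]
  · rw [hm, hv'.mem_iff]
  · have : proj T (v.filter (· ∉ T)) = [] := proj_eq_nil (by simp)
    rw [proj_append, proj_proj subset_rfl, this, List.append_nil]

end Admissible

lemma Admissible.exchanges {α β : List ℕ → List ℕ → Prop} (hα : Admissible α)
    (hβ : Admissible β) : Exchanges α β := by
  by_cases mα : ∀ {u v}, α u v → ∀ z, z ∈ u ↔ z ∈ v
  swap
  · exact (Exchanges.of_le hβ hα fun u v _ => hα.total_of_not_mem mα u v).1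
  by_cases mβ : ∀ {u v}, β u v → ∀ z, z ∈ u ↔ z ∈ v
  swap
  · exact (Exchanges.of_le hα hβ fun u v _ => hβ.total_of_not_mem mβ u v).2
  by_cases iα : ∀ {u v}, α u v → ∀ z, u.count z = 1 ↔ v.count z = 1
  swap
  · exact (Exchanges.of_le hβ hα fun u v h =>
      hα.of_idempotent (hα.idempotent_of_not_simple_iff mα iα) (mβ h)).1
  by_cases iβ : ∀ {u v}, β u v → ∀ z, u.count z = 1 ↔ v.count z = 1
  swap
  · exact (Exchanges.of_le hα hβ fun u v h =>
      hβ.of_idempotent (hβ.idempotent_of_not_simple_iff mβ iβ) (mα h)).2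
  by_cases sα : ∀ {u v} {T : Finset ℕ}, α u v → (∀ z, z ∈ T ↔ u.count z = 1) →
      proj T u = proj T v
  swap
  · exact (Exchanges.of_le hβ hα fun u v h =>
      hα.of_commutative (hα.commutative_of_not_simple mα iα sα) (mβ h) (iβ h)).1
  by_cases sβ : ∀ {u v} {T : Finset ℕ}, β u v → (∀ z, z ∈ T ↔ u.count z = 1) →
      proj T u = proj T v
  swap
  · exact (Exchanges.of_le hα hβ fun u v h =>
      hβ.of_commutative (hβ.commutative_of_not_simple mβ iβ sβ) (mα h) (iα h)).2
  by_cases gα : Gathers α 1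
  · exact (Exchanges.of_le hβ hα fun u v h => hα.of_gathers_one gα mem_simples
      (fun z => (mem_simples z).trans (iβ h z)) (mβ h) (sβ h mem_simples)).1
  by_cases gβ : Gathers β 1
  · exact (Exchanges.of_le hα hβ fun u v h => hβ.of_gathers_one gβ mem_simples
      (fun z => (mem_simples z).trans (iα h z)) (mα h) (sα h mem_simples)).2
  exact Faithful.exchanges ⟨mα, iα, sα, gα⟩ ⟨mβ, iβ, sβ, gβ⟩ hα hβ

lemma fiCon_of_mem {E : Set (FM × FM)} {p : FM × FM} (h : p ∈ E) : fiCon E p.1 p.2 :=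
  fun _ hc => hc.2 p h

lemma fiCon_isFullyInvariant (E : Set (FM × FM)) : IsFullyInvariant (fiCon E) :=
  fun σ u v h c hc => hc.1 σ u v (h c hc)

/-- The endomorphism assigning the given words to the letters `x, y, z, s, t`. -/
def assign (x y z s t : FM) : FM →* FM :=
  FreeMonoid.lift fun
    | 0 => x
    | 1 => y
    | 2 => z
    | 3 => s
    | 4 => t
    | _ => 1

section assign

variable (x y z s t : FM)

@[simp] lemma assign_xL : assign x y z s t xL = x := FreeMonoid.lift_eval_of _ _
@[simp] lemma assign_yL : assign x y z s t yL = y := FreeMonoid.lift_eval_of _ _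
@[simp] lemma assign_zL : assign x y z s t zL = z := FreeMonoid.lift_eval_of _ _
@[simp] lemma assign_sL : assign x y z s t sL = s := FreeMonoid.lift_eval_of _ _
@[simp] lemma assign_tL : assign x y z s t tL = t := FreeMonoid.lift_eval_of _ _

end assign

lemma θDinf_assign (x y z s t : FM) {u v : FM}
    (h : (u, v) ∈ ({(xL ^ 2, xL ^ 3), (xL ^ 2 * yL, yL * xL ^ 2), idσ1, idσ2, idσ3} :
      Set (FM × FM))) :
    θDinf (assign x y z s t u) (assign x y z s t v) :=
  fiCon_isFullyInvariant _ _ _ _ (fiCon_of_mem h)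

lemma θN_assign (x y z s t : FM) {u v : FM}
    (h : (u, v) ∈ ({(xL ^ 2, xL ^ 3), (xL ^ 2 * yL, yL * xL ^ 2),
      (xL * yL * xL * zL * xL, xL ^ 2 * yL * zL), idσ2, idσ3} : Set (FM × FM))) :
    θN (assign x y z s t u) (assign x y z s t v) :=
  fiCon_isFullyInvariant _ _ _ _ (fiCon_of_mem h)

lemma θDinf_cube (x : FM) : θDinf (x * x) (x * x * x) := by
  have := θDinf_assign x 1 1 1 1
    (u := xL ^ 2) (v := xL ^ 3) (by simp)
  simpa only [pow_two, pow_three, map_mul, assign_xL, assign_yL, assign_zL, mul_assoc] using this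

lemma θDinf_comm (x y : FM) : θDinf (x * x * y) (y * x * x) := by
  have := θDinf_assign x y 1 1 1
    (u := xL ^ 2 * yL) (v := yL * xL ^ 2) (by simp)
  simpa only [pow_two, pow_three, map_mul, assign_xL, assign_yL, assign_zL, mul_assoc] using this

lemma θDinf_first (x y s t : FM) : θDinf (x * y * s * x * t * y) (y * x * s * x * t * y) := by
  simpa [idσ1] using θDinf_assign x y 1 s t (u := idσ1.1) (v := idσ1.2) (by simp)

lemma θDinf_late (x y s t : FM) : θDinf (x * s * y * t * x * y) (x * s * y * t * y * x) := by
  simpa [idσ2] using θDinf_assign x y 1 s t (u := idσ2.1) (v := idσ2.2) (by simp)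

lemma θDinf_mid (x y s t : FM) : θDinf (x * s * x * y * t * y) (x * s * y * x * t * y) := by
  simpa [idσ3] using θDinf_assign x y 1 s t (u := idσ3.1) (v := idσ3.2) (by simp)

lemma θN_cube (x : FM) : θN (x * x) (x * x * x) := by
  have := θN_assign x 1 1 1 1
    (u := xL ^ 2) (v := xL ^ 3) (by simp)
  simpa only [pow_two, pow_three, map_mul, assign_xL, assign_yL, assign_zL, mul_assoc] using this

lemma θN_comm (x y : FM) : θN (x * x * y) (y * x * x) := by
  have := θN_assign x y 1 1 1
    (u := xL ^ 2 * yL) (v := yL * xL ^ 2) (by simp)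
  simpa only [pow_two, pow_three, map_mul, assign_xL, assign_yL, assign_zL, mul_assoc] using this

lemma θN_gather (x y z : FM) : θN (x * y * x * z * x) (x * x * y * z) := by
  have := θN_assign x y z 1 1
    (u := xL * yL * xL * zL * xL) (v := xL ^ 2 * yL * zL) (by simp)
  simpa only [pow_two, pow_three, map_mul, assign_xL, assign_yL, assign_zL, mul_assoc] using this

lemma θN_late (x y s t : FM) : θN (x * s * y * t * x * y) (x * s * y * t * y * x) := by
  simpa [idσ2] using θN_assign x y 1 s t (u := idσ2.1) (v := idσ2.2) (by simp)

lemma θN_mid (x y s t : FM) : θN (x * s * x * y * t * y) (x * s * y * x * t * y) := by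
  simpa [idσ3] using θN_assign x y 1 s t (u := idσ3.1) (v := idσ3.2) (by simp)

/-- A prefix can be moved past an element occurring three times. -/
lemma θN_swap (x y a b c : FM) :
    θN (x * (y * a) * x * b * x * c) (y * (x * a * x * b * x) * c) := by
  have h1 := θN.mul (θN_gather x (y * a) b) (θN.refl c)
  have h2 := θN.mul (θN_comm x y) (θN.refl (a * b * c))
  have h3 := θN.mul (θN.mul (θN.refl y) (θN.symm (θN_gather x a b))) (θN.refl c)
  simp only [mul_assoc] at h1 h2 h3 ⊢
  exact θN.trans h1 (θN.trans h2 h3)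

lemma ofList_flatMap (f : ℕ → List ℕ) (u : List ℕ) : FreeMonoid.ofList (u.flatMap f) =
    FreeMonoid.lift (fun a => FreeMonoid.ofList (f a)) (FreeMonoid.ofList u) := by
  induction u with
  | nil => simp
  | cons a u ih =>
    rw [List.flatMap_cons, FreeMonoid.ofList_append, ih, FreeMonoid.ofList_cons, map_mul,
      FreeMonoid.lift_eval_of]

lemma admissible_of_le {α : Con FM} (hα : IsFullyInvariant α) (h : θDinf ⊓ θN ≤ α) :
    Admissible fun u v => α (FreeMonoid.ofList u) (FreeMonoid.ofList v) where
  refl _ := α.refl _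
  symm := α.symm
  trans := α.trans
  app h1 h2 := by simpa only [FreeMonoid.ofList_append] using α.mul h1 h2
  subst f _ _ h1 := by simpa only [ofList_flatMap] using hα _ _ _ h1
  cube x := by
    simp only [FreeMonoid.ofList_append]
    exact h ⟨θDinf_cube _, θN_cube _⟩
  comm x y := by
    simp only [FreeMonoid.ofList_append]
    exact h ⟨θDinf_comm _ _, θN_comm _ _⟩
  late x y s t := by
    simp only [FreeMonoid.ofList_append]
    exact h ⟨θDinf_late _ _ _ _, θN_late _ _ _ _⟩
  mid x y s t := by
    simp only [FreeMonoid.ofList_append]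
    exact h ⟨θDinf_mid _ _ _ _, θN_mid _ _ _ _⟩
  early₁ x y s t k := by
    simp only [FreeMonoid.ofList_append]
    generalize FreeMonoid.ofList x = x, FreeMonoid.ofList y = y, FreeMonoid.ofList s = s,
      FreeMonoid.ofList t = t, FreeMonoid.ofList k = k
    exact h ⟨by simpa [mul_assoc] using θDinf_first x y s (t * x * k),
      by simpa [mul_assoc] using θN_swap x y s t (k * y)⟩
  early₂ x y s t k := by
    simp only [FreeMonoid.ofList_append]
    generalize FreeMonoid.ofList x = x, FreeMonoid.ofList y = y, FreeMonoid.ofList s = s,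
      FreeMonoid.ofList t = t, FreeMonoid.ofList k = k
    exact h ⟨by simpa [mul_assoc] using θDinf.mul (θDinf_first x y s t) (θDinf.refl (k * x)),
      by simpa [mul_assoc] using θN_swap x y s (t * y * k) 1⟩
  early₃ x y s t k := by
    simp only [FreeMonoid.ofList_append]
    generalize FreeMonoid.ofList x = x, FreeMonoid.ofList y = y, FreeMonoid.ofList s = s,
      FreeMonoid.ofList t = t, FreeMonoid.ofList k = k
    exact h ⟨by simpa [mul_assoc] using
        θDinf.mul (θDinf.symm (θDinf_first y x s t)) (θDinf.refl (k * x)),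
      by simpa [mul_assoc] using θN_swap x y (s * y * t) k 1⟩

/-- **Proposition 5.4.** The variety `D∞ ∨ N` is fi-permutable: any two fully
invariant congruences containing `θ_{D∞} ∩ θ_N` permute. -/
theorem Dinf_join_N_fi_permutable :
    ∀ α β : Con FM, IsFullyInvariant α → IsFullyInvariant β →
      (θDinf ⊓ θN) ≤ α → (θDinf ⊓ θN) ≤ β → Permute α β := by
  intro α β hα hβ h₁ h₂
  have Aα := admissible_of_le hα h₁
  have Aβ := admissible_of_le hβ h₂
  funext u w
  refine propext ⟨?_, ?_⟩
  · rintro ⟨m, hum, hmw⟩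
    exact Aα.exchanges Aβ hum hmw
  · rintro ⟨m, hum, hmw⟩
    exact Aβ.exchanges Aα hum hmw
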